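/- Let 0<α<n, 1<p<q<∞, and let (u,σ) be a pair of weights on ℝ^n. Then there exist constants c,C>0 depending only on n, α, p and q such that c·‖M_α(·u)‖_{L^{q'}(u)→L^{p'}(σ)} ≤ ‖I_α(·σ)‖_{L^p(σ)→L^{q,∞}(u)} ≤ C·‖M_α(·u)‖_{L^{q'}(u)→L^{p'}(σ)}; i.e., the weak (p,q) operator norm of the Riesz potential I_α(·σ) is comparable to the strong (q',p') operator norm of the fractional maximal operator M_α(·u). -/

import Mathlib

open MeasureTheory ENNReal Set

noncomputable section

/-- `ℝ^n` with Lebesgue measure. -/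
abbrev Rn (n : ℕ) : Type := Fin n → ℝ

/-- An axis-parallel (half-open) cube in `ℝ^n`. -/
structure Cube (n : ℕ) where
  corner : Fin n → ℝ
  side : ℝ
  side_pos : 0 < side

/-- The underlying set of a cube. -/
def Cube.set {n : ℕ} (Q : Cube n) : Set (Rn n) :=
  {x | ∀ i, Q.corner i ≤ x i ∧ x i < Q.corner i + Q.side}

/-- The volume `|Q|` of a cube. -/
def Cube.vol {n : ℕ} (Q : Cube n) : ℝ := Q.side ^ n

/-- Conjugate exponent `p' = p/(p-1)`. -/
def conjExp (p : ℝ) : ℝ := p / (p - 1)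

/-- Average over a cube of an `ℝ≥0∞`-valued function. -/
def avgE {n : ℕ} (Q : Cube n) (g : Rn n → ℝ≥0∞) : ℝ≥0∞ :=
  (∫⁻ x in Q.set, g x) / ENNReal.ofReal Q.vol

/-- Average over a cube of a (nonnegative) real weight. -/
def avgW {n : ℕ} (Q : Cube n) (w : Rn n → ℝ) : ℝ≥0∞ :=
  avgE Q fun x => ENNReal.ofReal (w x)

/-- Weighted `L^p` norm `‖f‖_{L^p(w)}` of an `ℝ≥0∞`-valued function. -/
def LpW {n : ℕ} (f : Rn n → ℝ≥0∞) (p : ℝ) (w : Rn n → ℝ) : ℝ≥0∞ :=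
  (∫⁻ x, f x ^ p * ENNReal.ofReal (w x)) ^ (1 / p)

/-- Weighted weak `L^q` quasinorm `‖f‖_{L^{q,∞}(w)}`. -/
def WeakLpW {n : ℕ} (f : Rn n → ℝ≥0∞) (q : ℝ) (w : Rn n → ℝ) : ℝ≥0∞ :=
  ⨆ (t : ℝ) (_ : 0 < t),
    ENNReal.ofReal t *
      (∫⁻ x in {x | ENNReal.ofReal t < f x}, ENNReal.ofReal (w x)) ^ (1 / q)

/-- The fractional maximal operator `M_α`. -/
def fracMax {n : ℕ} (α : ℝ) (f : Rn n → ℝ≥0∞) (x : Rn n) : ℝ≥0∞ :=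
  ⨆ (Q : Cube n) (_ : x ∈ Q.set),
    ENNReal.ofReal (Q.vol ^ (α / n - 1)) * ∫⁻ y in Q.set, f y

/-- The Euclidean norm on `ℝ^n`. -/
def eucNorm {n : ℕ} (x : Rn n) : ℝ := Real.sqrt (∑ i, x i ^ 2)

/-- The Riesz potential `I_α`. -/
def riesz {n : ℕ} (α : ℝ) (f : Rn n → ℝ≥0∞) (x : Rn n) : ℝ≥0∞ :=
  ∫⁻ y, f y * ENNReal.ofReal (eucNorm (x - y) ^ (α - n))

/-- The product `fσ` of an `ℝ≥0∞`-valued function with a weight. -/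
def mulW {n : ℕ} (f : Rn n → ℝ≥0∞) (w : Rn n → ℝ) : Rn n → ℝ≥0∞ :=
  fun x => f x * ENNReal.ofReal (w x)

/-- The operator norm `‖T(·σ)‖_{L^p(σ) → L^q(u)}` (least admissible constant). -/
def opNormStrong {n : ℕ} (T : (Rn n → ℝ≥0∞) → Rn n → ℝ≥0∞) (p q : ℝ)
    (σ u : Rn n → ℝ) : ℝ≥0∞ :=
  ⨆ (f : Rn n → ℝ≥0∞) (_ : Measurable f), LpW (T (mulW f σ)) q u / LpW f p σ

/-- The weak-type operator norm `‖T(·σ)‖_{L^p(σ) → L^{q,∞}(u)}`. -/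
def opNormWeak {n : ℕ} (T : (Rn n → ℝ≥0∞) → Rn n → ℝ≥0∞) (p q : ℝ)
    (σ u : Rn n → ℝ) : ℝ≥0∞ :=
  ⨆ (f : Rn n → ℝ≥0∞) (_ : Measurable f), WeakLpW (T (mulW f σ)) q u / LpW f p σ

/-- The operator norm `‖T‖_{L^p(v) → L^q(u)}` (no multiplication by the weight). -/
def opNormPlain {n : ℕ} (T : (Rn n → ℝ≥0∞) → Rn n → ℝ≥0∞) (p q : ℝ)
    (v u : Rn n → ℝ) : ℝ≥0∞ :=
  ⨆ (f : Rn n → ℝ≥0∞) (_ : Measurable f), LpW (T f) q u / LpW f p v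

/-- The weak-type operator norm `‖T‖_{L^p(v) → L^{q,∞}(u)}`. -/
def opNormPlainWeak {n : ℕ} (T : (Rn n → ℝ≥0∞) → Rn n → ℝ≥0∞) (p q : ℝ)
    (v u : Rn n → ℝ) : ℝ≥0∞ :=
  ⨆ (f : Rn n → ℝ≥0∞) (_ : Measurable f), WeakLpW (T f) q u / LpW f p v

/-- A weight: a nonnegative locally integrable (measurable) function. -/
def IsWeight {n : ℕ} (w : Rn n → ℝ) : Prop :=
  Measurable w ∧ (∀ x, 0 ≤ w x) ∧ LocallyIntegrable w volume

/-- The local `A^α_{p,q}` functional `A^α_{p,q}(u,σ,Q)`. -/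
def ApqQ {n : ℕ} (α p q : ℝ) (u σ : Rn n → ℝ) (Q : Cube n) : ℝ≥0∞ :=
  ENNReal.ofReal (Q.vol ^ (α / n + 1 / q - 1 / p)) * avgW Q u ^ (1 / q) *
    avgW Q σ ^ (1 / conjExp p)

/-- The joint constant `[u,σ]_{A^α_{p,q}}`. -/
def Apq {n : ℕ} (α p q : ℝ) (u σ : Rn n → ℝ) : ℝ≥0∞ :=
  ⨆ Q : Cube n, ApqQ α p q u σ Q

/-- `A^α_{p,q}` for `ℝ≥0∞`-valued weights. -/
def ApqE {n : ℕ} (α p q : ℝ) (u σ : Rn n → ℝ≥0∞) : ℝ≥0∞ :=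
  ⨆ Q : Cube n,
    ENNReal.ofReal (Q.vol ^ (α / n + 1 / q - 1 / p)) * avgE Q u ^ (1 / q) *
      avgE Q σ ^ (1 / conjExp p)

/-- Real-valued average over a cube. -/
def avgR {n : ℕ} (Q : Cube n) (w : Rn n → ℝ) : ℝ := (∫ x in Q.set, w x) / Q.vol

/-- The local exponential `A_∞` functional `A^{exp}_∞(w,Q)`. -/
def AexpQ {n : ℕ} (Q : Cube n) (w : Rn n → ℝ) : ℝ :=
  avgR Q w * Real.exp (- avgR Q fun x => Real.log (w x))

/-- `w ∈ A_∞` (exponential definition). -/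
def IsAinf {n : ℕ} (w : Rn n → ℝ) : Prop :=
  ∃ C : ℝ, ∀ Q : Cube n,
    IntegrableOn (fun x => Real.log (w x)) Q.set volume ∧ AexpQ Q w ≤ C

/-- The local Fujii–Wilson functional `A^M_∞(w,Q) = w(Q)⁻¹ ∫_Q M(wχ_Q)`. -/
def FWQ {n : ℕ} (Q : Cube n) (w : Rn n → ℝ) : ℝ≥0∞ :=
  (∫⁻ x in Q.set, fracMax 0 (Q.set.indicator fun y => ENNReal.ofReal (w y)) x) /
    ∫⁻ x in Q.set, ENNReal.ofReal (w x)

/-- The Fujii–Wilson constant `[w]_{A^M_∞}`. -/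
def FW {n : ℕ} (w : Rn n → ℝ) : ℝ≥0∞ := ⨆ Q : Cube n, FWQ Q w

/-- The local Muckenhoupt `A_r` functional. -/
def ArQ {n : ℕ} (r : ℝ) (v : Rn n → ℝ) (Q : Cube n) : ℝ≥0∞ :=
  avgW Q v * (avgE Q fun x => ENNReal.ofReal (v x) ^ (1 - conjExp r)) ^ (r - 1)

/-- The Muckenhoupt constant `[v]_{A_r}`. -/
def ArC {n : ℕ} (r : ℝ) (v : Rn n → ℝ) : ℝ≥0∞ := ⨆ Q : Cube n, ArQ r v Q

/-- The mixed constant `[v]_{(A_r)^β (A^M_∞)^γ}`. -/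
def mixedC {n : ℕ} (r β γ : ℝ) (v : Rn n → ℝ) : ℝ≥0∞ :=
  ⨆ Q : Cube n, ArQ r v Q ^ β * FWQ Q v ^ γ

/-- `Φ(t) = 1 + log t` applied to an `ℝ≥0∞` constant. -/
def PhiLog (X : ℝ≥0∞) : ℝ≥0∞ :=
  if X = ∞ then ∞ else ENNReal.ofReal (1 + Real.log X.toReal)

/-- A Young function. -/
def IsYoung (Φ : ℝ → ℝ) : Prop :=
  ContinuousOn Φ (Ici 0) ∧ ConvexOn ℝ (Ici 0) Φ ∧ StrictMonoOn Φ (Ici 0) ∧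
    Φ 0 = 0 ∧ Filter.Tendsto (fun t => Φ t / t) Filter.atTop Filter.atTop

/-- The associate (conjugate) Young function `Φ̄(t) = sup_{s>0} (st - Φ(s))`. -/
def assocFn (Φ : ℝ → ℝ) (t : ℝ) : ℝ :=
  sSup {y : ℝ | ∃ s : ℝ, 0 < s ∧ y = s * t - Φ s}

/-- The localized Luxemburg average `‖f‖_{Φ,Q}`. -/
def luxNorm {n : ℕ} (Φ : ℝ → ℝ) (Q : Cube n) (f : Rn n → ℝ) : ℝ≥0∞ :=
  sInf ((fun l : ℝ => ENNReal.ofReal l) ''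
    {l : ℝ | 0 < l ∧
      (∫⁻ x in Q.set, ENNReal.ofReal (Φ (|f x| / l))) ≤ ENNReal.ofReal Q.vol})

/-- The fractional Orlicz maximal operator `M_{β,Φ}`. -/
def orliczMax {n : ℕ} (β : ℝ) (Φ : ℝ → ℝ) (f : Rn n → ℝ) (x : Rn n) : ℝ≥0∞ :=
  ⨆ (Q : Cube n) (_ : x ∈ Q.set), ENNReal.ofReal (Q.vol ^ (β / n)) * luxNorm Φ Q f

/-- Unweighted `L^p` norm of a real function. -/
def Lp0 {n : ℕ} (f : Rn n → ℝ) (p : ℝ) : ℝ≥0∞ :=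
  (∫⁻ x, ENNReal.ofReal |f x| ^ p) ^ (1 / p)

/-- Unweighted `L^p` norm of an `ℝ≥0∞`-valued function. -/
def LpE {n : ℕ} (g : Rn n → ℝ≥0∞) (p : ℝ) : ℝ≥0∞ :=
  (∫⁻ x, g x ^ p) ^ (1 / p)

/-- The unweighted operator norm `‖M_{β,Φ}‖_{L^p → L^q}`. -/
def orliczMaxNorm (n : ℕ) (β : ℝ) (Φ : ℝ → ℝ) (p q : ℝ) : ℝ≥0∞ :=
  ⨆ (f : Rn n → ℝ) (_ : Measurable f), LpE (orliczMax β Φ f) q / Lp0 f p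

/-- The `B^β_p` integral `∫_c^∞ Φ(t)^{q/p} t^{-q} dt/t`, where `1/q = 1/p - β/n`. -/
def BInt (Φ : ℝ → ℝ) (p q : ℝ) (c : ℝ) : ℝ≥0∞ :=
  ∫⁻ t in Ioi c, ENNReal.ofReal (Φ t ^ (q / p) * t ^ (-q) / t)

/-- The `B^β_p` condition (with `q` given by `1/q = 1/p - β/n`). -/
def BCond (Φ : ℝ → ℝ) (p q : ℝ) : Prop := ∃ c : ℝ, 0 < c ∧ BInt Φ p q c < ∞

/-- The bump constant `[u,σ]_{A^α_{p,q,Φ}}`. -/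
def bumpA {n : ℕ} (α p q : ℝ) (Φ : ℝ → ℝ) (u σ : Rn n → ℝ) : ℝ≥0∞ :=
  ⨆ Q : Cube n,
    ENNReal.ofReal (Q.vol ^ (α / n + 1 / q - 1 / p)) * avgW Q u ^ (1 / q) *
      luxNorm Φ Q (fun x => σ x ^ (1 / conjExp p))

/-- A dyadic grid in `ℝ^n`. -/
def IsDyadicGrid {n : ℕ} (D : Set (Cube n)) : Prop :=
  (∀ Q ∈ D, ∃ k : ℤ, Q.side = (2 : ℝ) ^ k) ∧
  (∀ Q ∈ D, ∀ P ∈ D, Q.set ∩ P.set = P.set ∨ Q.set ∩ P.set = Q.set ∨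
    Q.set ∩ P.set = ∅) ∧
  (∀ k : ℤ, ∀ x : Rn n, ∃! Q : Cube n, Q ∈ D ∧ Q.side = (2 : ℝ) ^ k ∧ x ∈ Q.set)

/-- The outer dyadic Riesz potential `I_α^{Q₀}`. -/
def outerRiesz {n : ℕ} (D : Set (Cube n)) (α : ℝ) (Q₀ : Cube n)
    (f : Rn n → ℝ≥0∞) (x : Rn n) : ℝ≥0∞ :=
  ∑' Q : {Q : Cube n // Q ∈ D ∧ Q₀.set ⊆ Q.set},
    Q.1.set.indicator
      (fun _ => ENNReal.ofReal (Q.1.vol ^ (α / n - 1)) * ∫⁻ y in Q.1.set, f y) x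

/-- The outer testing constant `[u,σ]_{I_α^{out},p,q}`. -/
def outerTest {n : ℕ} (D : Set (Cube n)) (α p q : ℝ) (u σ : Rn n → ℝ) : ℝ≥0∞ :=
  ⨆ (Q₀ : Cube n) (_ : Q₀ ∈ D),
    (∫⁻ x, outerRiesz D α Q₀ (Q₀.set.indicator fun y => ENNReal.ofReal (σ y)) x ^ q *
        ENNReal.ofReal (u x)) ^ (1 / q) /
      (∫⁻ x in Q₀.set, ENNReal.ofReal (σ x)) ^ (1 / p)

/-- The dyadic fractional maximal operator `M_α^𝒟`. -/
def dyadicFracMax {n : ℕ} (D : Set (Cube n)) (α : ℝ) (f : Rn n → ℝ≥0∞)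
    (x : Rn n) : ℝ≥0∞ :=
  ⨆ (Q : Cube n) (_ : Q ∈ D) (_ : x ∈ Q.set),
    ENNReal.ofReal (Q.vol ^ (α / n - 1)) * ∫⁻ y in Q.set, f y

/-- A sparse family `S ⊆ D` with associated disjoint thick subsets `E Q ⊆ Q`. -/
def IsSparse {n : ℕ} (D S : Set (Cube n)) (E : Cube n → Set (Rn n)) : Prop :=
  S ⊆ D ∧
  (∀ Q ∈ S, E Q ⊆ Q.set ∧ MeasurableSet (E Q) ∧
    ENNReal.ofReal Q.vol ≤ 2 * volume (E Q)) ∧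
  S.PairwiseDisjoint E

/-- The sparse operator `L_α^S`. -/
def sparseOp {n : ℕ} (S : Set (Cube n)) (E : Cube n → Set (Rn n)) (α : ℝ)
    (f : Rn n → ℝ≥0∞) (x : Rn n) : ℝ≥0∞ :=
  ∑' Q : S,
    (E Q.1).indicator
      (fun _ => ENNReal.ofReal (Q.1.vol ^ (α / n - 1)) * ∫⁻ y in Q.1.set, f y) x

/-- The one-dimensional fractional maximal operator over bounded intervals. -/
def fm1 (γ : ℝ) (f : ℝ → ℝ≥0∞) (x : ℝ) : ℝ≥0∞ :=
  ⨆ (a : ℝ) (b : ℝ) (_ : a < b) (_ : x ∈ Icc a b),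
    ENNReal.ofReal ((b - a) ^ (γ - 1)) * ∫⁻ y in Ioo a b, f y

/-- The sum of the geometric series of ratio `2 ^ (-δ)`. -/
def geomConst (δ : ℝ) : ℝ≥0∞ := (1 - (2 : ℝ≥0∞) ^ (-δ))⁻¹

lemma geomConst_ne_top {δ : ℝ} (hδ : 0 < δ) : geomConst δ ≠ ∞ := by
  have h : (2 : ℝ≥0∞) ^ (-δ) < 1 :=
    ENNReal.rpow_lt_one_of_one_lt_of_neg (by norm_num) (by linarith)
  simpa [geomConst, tsub_eq_zero_iff_le] using h

lemma geomConst_ne_zero (δ : ℝ) : geomConst δ ≠ 0 := by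
  simp [geomConst, ENNReal.sub_eq_top_iff]

lemma tsum_two_rpow_neg_pow (δ : ℝ) :
    ∑' i : ℕ, ((2 : ℝ≥0∞) ^ (-δ)) ^ i = geomConst δ :=
  ENNReal.tsum_geometric _

lemma two_rpow_ne_zero (y : ℝ) : (2 : ℝ≥0∞) ^ y ≠ 0 :=
  (ENNReal.rpow_pos (by norm_num) (by norm_num)).ne'

lemma two_rpow_add (y z : ℝ) : (2 : ℝ≥0∞) ^ (y + z) = 2 ^ y * 2 ^ z :=
  ENNReal.rpow_add _ _ (by norm_num) (by norm_num)

lemma two_rpow_neg_mul_natCast (δ : ℝ) (i : ℕ) :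
    (2 : ℝ≥0∞) ^ (-(δ * i)) = ((2 : ℝ≥0∞) ^ (-δ)) ^ i := by
  rw [← ENNReal.rpow_natCast, ← ENNReal.rpow_mul, neg_mul]

lemma exists_two_rpow_lt_le {t : ℝ≥0∞} (h0 : t ≠ 0) (ht : t ≠ ∞) :
    ∃ j : ℤ, (2 : ℝ≥0∞) ^ (j : ℝ) < t ∧ t ≤ 2 ^ ((j : ℝ) + 1) := by
  obtain ⟨j, h1, h2⟩ := ENNReal.exists_mem_Ioc_zpow h0 ht (y := 2) (by norm_num) (by norm_num)
  refine ⟨j, by rwa [ENNReal.rpow_intCast], ?_⟩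
  have : ((j : ℝ) + 1) = ((j + 1 : ℤ) : ℝ) := by push_cast; ring
  rwa [this, ENNReal.rpow_intCast]

lemma two_rpow_lt_two_rpow {y z : ℝ} (h : (2 : ℝ≥0∞) ^ y < 2 ^ z) : y < z := by
  by_contra! hc
  exact absurd h (not_lt.2 (ENNReal.rpow_le_rpow_of_exponent_le (by norm_num) hc))

lemma tsum_two_rpow_le {δ : ℝ} (hδ : 0 < δ) (t : ℝ≥0∞) :
    ∑' k : ℤ, (if (2 : ℝ≥0∞) ^ (k : ℝ) < t then (2 : ℝ≥0∞) ^ (k * δ) else 0) ≤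
      geomConst δ * t ^ δ := by
  rcases eq_or_ne t 0 with rfl | h0
  · simp
  rcases eq_or_ne t ∞ with rfl | ht
  · rw [ENNReal.top_rpow_of_pos hδ, ENNReal.mul_top (geomConst_ne_zero δ)]
    exact le_top
  obtain ⟨j, hj1, hj2⟩ := exists_two_rpow_lt_le h0 ht
  have hinj : Function.Injective (fun i : ℕ => j - (i : ℤ)) := fun a b h => by
    simp only at h; omega
  rw [← hinj.tsum_eq]
  · calc _ ≤ ∑' i : ℕ, t ^ δ * ((2 : ℝ≥0∞) ^ (-δ)) ^ i := by
          refine ENNReal.tsum_le_tsum fun i => ?_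
          split_ifs
          · have : (((j - (i : ℤ) : ℤ) : ℝ) * δ) = j * δ + -(δ * i) := by push_cast; ring
            rw [this, two_rpow_add, two_rpow_neg_mul_natCast, ENNReal.rpow_mul]
            gcongr
          · exact zero_le
      _ = _ := by rw [ENNReal.tsum_mul_left, tsum_two_rpow_neg_pow, mul_comm]
  · intro k hk
    have hk' : (2 : ℝ≥0∞) ^ (k : ℝ) < t := by
      by_contra hc
      exact hk (if_neg hc)
    have h3 : (k : ℝ) < (j + 1 : ℤ) := by
      push_cast
      exact two_rpow_lt_two_rpow (hk'.trans_le hj2)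
    have h4 : k < j + 1 := by exact_mod_cast h3
    exact ⟨(j - k).toNat, by simp only; omega⟩

lemma ENNReal.tsum_rpow_le_rpow_tsum {ι : Type*} (b : ι → ℝ≥0∞) {t : ℝ} (ht : 1 ≤ t) :
    ∑' i, b i ^ t ≤ (∑' i, b i) ^ t := by
  have key : ∀ x : ℝ≥0∞, x ^ t = x * x ^ (t - 1) := fun x => by
    have := ENNReal.rpow_add_of_nonneg (x := x) 1 (t - 1) (by norm_num) (by linarith)
    rwa [add_sub_cancel, ENNReal.rpow_one] at this
  calc ∑' i, b i ^ t ≤ ∑' i, b i * (∑' i, b i) ^ (t - 1) := by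
        refine ENNReal.tsum_le_tsum fun i => ?_
        rw [key]
        exact mul_le_mul_right (ENNReal.rpow_le_rpow (ENNReal.le_tsum i) (by linarith)) _
    _ = _ := by rw [ENNReal.tsum_mul_right, ← key]

lemma ENNReal.rpow_tsum_le {ι : Type*} {b w c : ι → ℝ≥0∞} (h : ∀ i, b i ≤ w i * c i)
    {r : ℝ} (hr : 0 < r) :
    (∑' i, b i) ^ r ≤ (∑' i, w i) ^ r * ∑' i, c i ^ r := by
  have h1 : ∑' i, b i ≤ (∑' i, w i) * (∑' i, c i ^ r) ^ (1 / r) := by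
    rw [← ENNReal.tsum_mul_right]
    refine ENNReal.tsum_le_tsum fun i => (h i).trans ?_
    gcongr
    calc c i = (c i ^ r) ^ (1 / r) := by
          rw [← ENNReal.rpow_mul, mul_one_div_cancel hr.ne', ENNReal.rpow_one]
      _ ≤ _ := by gcongr; exact ENNReal.le_tsum i
  calc _ ≤ ((∑' i, w i) * (∑' i, c i ^ r) ^ (1 / r)) ^ r := by gcongr
    _ = _ := by
      rw [ENNReal.mul_rpow_of_nonneg _ _ hr.le, ← ENNReal.rpow_mul,
        one_div_mul_cancel hr.ne', ENNReal.rpow_one]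

lemma le_two_rpow_neg_pow_mul {a : ℕ → ℝ≥0∞} {β : ℝ}
    (ha : ∀ i, a i ≤ 2 ^ (-β) * a (i + 1)) (i k : ℕ) :
    a i ≤ ((2 : ℝ≥0∞) ^ (-β)) ^ k * a (i + k) := by
  induction k with
  | zero => simp
  | succ k ih =>
    calc a i ≤ ((2 : ℝ≥0∞) ^ (-β)) ^ k * (2 ^ (-β) * a (i + k + 1)) :=
          ih.trans (by gcongr; exact ha _)
      _ = _ := by rw [pow_succ, mul_assoc]; rfl

lemma tsum_geometric_le_iSup {a : ℕ → ℝ≥0∞} {β : ℝ}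
    (ha : ∀ i, a i ≤ 2 ^ (-β) * a (i + 1)) (S : Set ℕ) [DecidablePred (· ∈ S)] :
    ∑' i, (if i ∈ S then a i else 0) ≤ geomConst β * ⨆ i ∈ S, a i := by
  rw [ENNReal.tsum_eq_iSup_sum]
  refine iSup_le fun F => ?_
  rw [← Finset.sum_filter]
  set F' := F.filter (· ∈ S)
  rcases F'.eq_empty_or_nonempty with h0 | h0
  · simp [h0]
  set l := F'.max' h0
  have hl : l ∈ S := (Finset.mem_filter.1 (F'.max'_mem h0)).2
  have hle : ∀ i ∈ F', i ≤ l := fun i hi => F'.le_max' i hi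
  calc ∑ i ∈ F', a i ≤ ∑ i ∈ F', ((2 : ℝ≥0∞) ^ (-β)) ^ (l - i) * a l := by
        refine Finset.sum_le_sum fun i hi => ?_
        have := le_two_rpow_neg_pow_mul ha i (l - i)
        rwa [Nat.add_sub_cancel' (hle i hi)] at this
    _ = (∑ i ∈ F', ((2 : ℝ≥0∞) ^ (-β)) ^ (l - i)) * a l := by rw [Finset.sum_mul]
    _ ≤ (∑ i ∈ Finset.range (l + 1), ((2 : ℝ≥0∞) ^ (-β)) ^ (l - i)) * a l := by
        gcongr
        intro i hi
        simpa [Nat.lt_succ_iff] using hle i hi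
    _ = (∑ i ∈ Finset.range (l + 1), ((2 : ℝ≥0∞) ^ (-β)) ^ i) * a l := by
        congr 1
        exact Finset.sum_range_reflect (fun i => ((2 : ℝ≥0∞) ^ (-β)) ^ i) (l + 1)
    _ ≤ _ := by
        rw [← tsum_two_rpow_neg_pow]
        gcongr
        · exact ENNReal.sum_le_tsum _
        · exact le_iSup₂ (f := fun i (_ : i ∈ S) => a i) l hl

section Refining

set_option linter.unusedSectionVars false

variable {X ι : Type} [MeasurableSpace X] [MeasurableSpace ι] [Countable ι]
  [MeasurableSingletonClass ι]

/-- The cell of the `i`-th partition that contains `x`. -/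
def cell (idx : ℕ → X → ι) (i : ℕ) (x : X) : Set X := {y | idx i y = idx i x}

/-- The maximal operator of a refining sequence of partitions, applied to a measure. -/
def dyMax (idx : ℕ → X → ι) (a : ℕ → ℝ≥0∞) (m : Measure X) (x : X) : ℝ≥0∞ :=
  ⨆ i, a i * m (cell idx i x)

/-- The positive operator of a refining sequence of partitions, applied to a measure. -/
def dySum (idx : ℕ → X → ι) (a : ℕ → ℝ≥0∞) (m : Measure X) (x : X) : ℝ≥0∞ :=
  ∑' i, a i * m (cell idx i x)

/-- A refining sequence of countable measurable partitions. -/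
structure IsRefining (idx : ℕ → X → ι) : Prop where
  measurable : ∀ i, Measurable (idx i)
  refine : ∀ i x y, idx (i + 1) x = idx (i + 1) y → idx i x = idx i y

lemma cell_eq {idx : ℕ → X → ι} {i : ℕ} {x y : X} (h : idx i x = idx i y) :
    cell idx i x = cell idx i y := by
  simp [cell, h]

/-- The points of index `v` where `P` holds for the first time at step `i`. -/
def firstHit (idx : ℕ → X → ι) (P : ℕ → X → Prop) (c : ℕ × ι) : Set X :=
  {x | idx c.1 x = c.2 ∧ P c.1 x ∧ ∀ j < c.1, ¬ P j x}

namespace IsRefining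

variable {idx : ℕ → X → ι} (h : IsRefining idx)
include h

lemma measurableSet_cell (i : ℕ) (x : X) : MeasurableSet (cell idx i x) :=
  h.measurable i (measurableSet_singleton (idx i x))

lemma idx_eq_of_le {i j : ℕ} (hij : i ≤ j) {x y : X} (hxy : idx j x = idx j y) :
    idx i x = idx i y := by
  induction j, hij using Nat.le_induction with
  | base => exact hxy
  | succ j _ ih => exact ih (h.refine j x y hxy)

lemma cell_subset {i j : ℕ} (hij : i ≤ j) (x : X) : cell idx j x ⊆ cell idx i x :=
  fun _ hy => h.idx_eq_of_le hij hy

lemma measurable_measure_cell (m : Measure X) (i : ℕ) :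
    Measurable fun x => m (cell idx i x) := by
  have : (fun x => m (cell idx i x)) = (fun v => m (idx i ⁻¹' {v})) ∘ idx i := rfl
  rw [this]
  exact (measurable_of_countable _).comp (h.measurable i)

lemma measurable_dyMax (a : ℕ → ℝ≥0∞) (m : Measure X) : Measurable (dyMax idx a m) :=
  Measurable.iSup fun i => (h.measurable_measure_cell m i).const_mul _

lemma measurable_dySum (a : ℕ → ℝ≥0∞) (m : Measure X) : Measurable (dySum idx a m) :=
  Measurable.tsum fun i => (h.measurable_measure_cell m i).const_mul _

variable {P : ℕ → X → Prop} (hP : ∀ i x y, idx i x = idx i y → (P i x ↔ P i y))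
include hP

lemma firstHit_eq_cell {c : ℕ × ι} {x : X} (hx : x ∈ firstHit idx P c) :
    firstHit idx P c = cell idx c.1 x := by
  obtain ⟨h1, h2, h3⟩ := hx
  ext y
  refine ⟨fun hy => hy.1.trans h1.symm, fun hy => ⟨Eq.trans hy h1, ?_, fun j hj => ?_⟩⟩
  · exact (hP _ _ _ hy).2 h2
  · rw [hP j y x (h.idx_eq_of_le hj.le hy)]
    exact h3 j hj

lemma measurableSet_firstHit (c : ℕ × ι) : MeasurableSet (firstHit idx P c) := by
  rcases (firstHit idx P c).eq_empty_or_nonempty with h0 | ⟨x, hx⟩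
  · simp [h0]
  · rw [h.firstHit_eq_cell hP hx]
    exact h.measurableSet_cell _ _

omit h hP in
lemma _root_.pairwise_disjoint_firstHit :
    Pairwise (Function.onFun Disjoint (firstHit idx P)) := by
  intro c d hcd
  refine Set.disjoint_left.2 fun x hx hy => hcd ?_
  have : c.1 = d.1 := by
    rcases lt_trichotomy c.1 d.1 with hl | hl | hl
    · exact absurd hx.2.1 (hy.2.2 _ hl)
    · exact hl
    · exact absurd hy.2.1 (hx.2.2 _ hl)
  refine Prod.ext this ?_
  rw [← hx.1, ← hy.1, this]

omit h hP in
lemma _root_.iUnion_firstHit : ⋃ c, firstHit idx P c = {x | ∃ i, P i x} := by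
  classical
  ext x
  simp only [mem_iUnion, mem_ofPred_eq]
  constructor
  · rintro ⟨c, hc⟩
    exact ⟨c.1, hc.2.1⟩
  · intro hx
    exact ⟨(Nat.find hx, idx (Nat.find hx) x), rfl, Nat.find_spec hx,
      fun j hj => Nat.find_min hx hj⟩

omit hP in
lemma mul_measure_hit_le (m m' : Measure X) (l : ℝ≥0∞) :
    l * m {x | ∃ i, l * m (cell idx i x) < m' (cell idx i x)} ≤ m' univ := by
  set P : ℕ → X → Prop := fun i x => l * m (cell idx i x) < m' (cell idx i x)
  have hP : ∀ i x y, idx i x = idx i y → (P i x ↔ P i y) := fun i x y hxy => by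
    simp only [P, cell_eq hxy]
  have hmeas := h.measurableSet_firstHit hP
  calc l * m {x | ∃ i, P i x} = ∑' c, l * m (firstHit idx P c) := by
        rw [← iUnion_firstHit (idx := idx),
          measure_iUnion pairwise_disjoint_firstHit hmeas, ENNReal.tsum_mul_left]
    _ ≤ ∑' c, m' (firstHit idx P c) := by
        refine ENNReal.tsum_le_tsum fun c => ?_
        rcases (firstHit idx P c).eq_empty_or_nonempty with h0 | ⟨x, hx⟩
        · simp [h0]
        · rw [h.firstHit_eq_cell hP hx]
          exact hx.2.1.le
    _ ≤ m' univ := tsum_measure_le_measure_univ (fun c => (hmeas c).nullMeasurableSet)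
        (fun c d hcd => (pairwise_disjoint_firstHit hcd).aedisjoint)

omit hP in
lemma mul_measure_level_le (μ : Measure X) (g : X → ℝ≥0∞) (l : ℝ≥0∞) :
    l * μ {x | ∃ i, 2 * l * μ (cell idx i x) < μ.withDensity g (cell idx i x)} ≤
      ∫⁻ x, (if l < g x then g x else 0) ∂μ := by
  set g₁ : X → ℝ≥0∞ := fun x => if l < g x then g x else 0
  have hle : ∀ x, g x ≤ g₁ x + l := fun x => by
    simp only [g₁]
    split_ifs with hx
    · exact le_self_add
    · simpa using hx
  calc _ ≤ l * μ {x | ∃ i, l * μ (cell idx i x) < μ.withDensity g₁ (cell idx i x)} := by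
        refine mul_le_mul_right (measure_mono ?_) _
        rintro x ⟨i, hi⟩
        refine ⟨i, ?_⟩
        by_contra! hc
        refine absurd hi (not_lt.2 ?_)
        have hC := h.measurableSet_cell i x
        rw [withDensity_apply _ hC] at hc ⊢
        calc ∫⁻ y in cell idx i x, g y ∂μ ≤ ∫⁻ y in cell idx i x, (g₁ y + l) ∂μ :=
              lintegral_mono fun y => hle y
          _ = (∫⁻ y in cell idx i x, g₁ y ∂μ) + l * μ (cell idx i x) := by
              rw [lintegral_add_right _ measurable_const, setLIntegral_const]
          _ ≤ _ := by
              rw [two_mul, add_mul]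
              gcongr
    _ ≤ μ.withDensity g₁ univ := h.mul_measure_hit_le _ _ _
    _ = _ := by simp [withDensity_apply]

omit hP in
lemma tsum_mul_measure_level_le (μ : Measure X) {g : X → ℝ≥0∞} (hg : Measurable g) {s : ℝ}
    (hs : 1 < s) :
    ∑' k : ℤ, (2 : ℝ≥0∞) ^ (k * s) * μ {x | ∃ i, 2 * (2 : ℝ≥0∞) ^ (k : ℝ) * μ (cell idx i x) <
      μ.withDensity g (cell idx i x)} ≤ geomConst (s - 1) * ∫⁻ x, g x ^ s ∂μ := by
  calc _ ≤ ∑' k : ℤ, (2 : ℝ≥0∞) ^ (k * (s - 1)) *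
        ∫⁻ x, (if (2 : ℝ≥0∞) ^ (k : ℝ) < g x then g x else 0) ∂μ := by
        refine ENNReal.tsum_le_tsum fun k => ?_
        have : (k * s : ℝ) = k * (s - 1) + k := by ring
        rw [this, two_rpow_add, mul_assoc]
        gcongr
        exact h.mul_measure_level_le μ g _
    _ = ∫⁻ x, ∑' k : ℤ, (2 : ℝ≥0∞) ^ (k * (s - 1)) *
          (if (2 : ℝ≥0∞) ^ (k : ℝ) < g x then g x else 0) ∂μ := by
        rw [lintegral_tsum]
        · refine tsum_congr fun k => ?_
          rw [lintegral_const_mul]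
          exact Measurable.ite (measurableSet_lt measurable_const hg) hg measurable_const
        · exact fun k => ((Measurable.ite (measurableSet_lt measurable_const hg) hg
            measurable_const).const_mul _).aemeasurable
    _ ≤ ∫⁻ x, geomConst (s - 1) * g x ^ s ∂μ := by
        refine lintegral_mono fun x => ?_
        calc _ = (∑' k : ℤ, (if (2 : ℝ≥0∞) ^ (k : ℝ) < g x then
              (2 : ℝ≥0∞) ^ (k * (s - 1)) else 0)) * g x := by
              rw [← ENNReal.tsum_mul_right]
              refine tsum_congr fun k => ?_
              split_ifs <;> simp
          _ ≤ geomConst (s - 1) * g x ^ (s - 1) * g x := by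
              gcongr
              exact tsum_two_rpow_le (by linarith) _
          _ = _ := by
              have := ENNReal.rpow_add_of_nonneg (x := g x) (s - 1) 1 (by linarith) (by norm_num)
              rw [sub_add_cancel, ENNReal.rpow_one] at this
              rw [this, mul_assoc]
    _ = _ := lintegral_const_mul _ (hg.pow_const _)

omit hP in
/-- A maximal operator which is bounded on indicator functions is bounded on `L^s`. -/
lemma lintegral_dyMax_rpow_le {a : ℕ → ℝ≥0∞} {μ ν : Measure X} {s r : ℝ} (hs : 1 < s)
    (hsr : s ≤ r) (hμ : ∀ i x, μ (cell idx i x) ≠ ∞) {A : ℝ≥0∞}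
    (hA : ∀ E, MeasurableSet E → μ E ≠ ∞ →
      ∫⁻ x, dyMax idx a (μ.restrict E) x ^ r ∂ν ≤ A * μ E ^ (r / s))
    {g : X → ℝ≥0∞} (hg : Measurable g) (hgs : ∫⁻ x, g x ^ s ∂μ ≠ ∞) :
    ∫⁻ x, dyMax idx a (μ.withDensity g) x ^ r ∂ν ≤
      4 ^ r * geomConst (s - 1) ^ (r / s) * A * (∫⁻ x, g x ^ s ∂μ) ^ (r / s) := by
  have hs0 : 0 < s := by linarith
  have hr0 : 0 < r := by linarith
  set Ω : ℤ → Set X := fun k => {x | ∃ i, 2 * (2 : ℝ≥0∞) ^ (k : ℝ) * μ (cell idx i x) <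
      μ.withDensity g (cell idx i x)} with hΩ
  have hΩmeas : ∀ k, MeasurableSet (Ω k) := fun k => by
    simp only [hΩ, ofPred_exists]
    exact MeasurableSet.iUnion fun i => measurableSet_lt
      ((h.measurable_measure_cell _ _).const_mul _) (h.measurable_measure_cell _ _)
  have hsum := h.tsum_mul_measure_level_le μ hg hs
  have hΩfin : ∀ k, μ (Ω k) ≠ ∞ := fun k hk => by
    have h1 := (ENNReal.le_tsum k).trans hsum
    change (2 : ℝ≥0∞) ^ (k * s) * μ (Ω k) ≤ _ at h1
    rw [hk, ENNReal.mul_top (two_rpow_ne_zero _), top_le_iff] at h1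
    exact ENNReal.mul_ne_top (geomConst_ne_top (by linarith)) hgs h1
  have hpt : ∀ x, dyMax idx a (μ.withDensity g) x ^ r ≤
      ∑' k : ℤ, (4 ^ r * (2 : ℝ≥0∞) ^ (k * r)) * dyMax idx a (μ.restrict (Ω k)) x ^ r := by
    intro x
    have h1 : dyMax idx a (μ.withDensity g) x ≤
        (∑' k : ℤ, (4 ^ r * (2 : ℝ≥0∞) ^ (k * r)) *
          dyMax idx a (μ.restrict (Ω k)) x ^ r) ^ (1 / r) := by
      refine iSup_le fun i => ?_
      set G := μ.withDensity g (cell idx i x) with hG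
      set m := μ (cell idx i x) with hm
      rcases eq_or_ne G 0 with hG0 | hG0
      · simp [hG0]
      have hm0 : m ≠ 0 := fun h0 => hG0 (withDensity_absolutelyContinuous _ _ h0)
      have hGtop : G ≠ ∞ := by
        rw [hG, withDensity_apply _ (h.measurableSet_cell i x)]
        refine ne_top_of_le_ne_top (ENNReal.add_ne_top.2 ⟨hμ i x, hgs⟩) ?_
        calc ∫⁻ y in cell idx i x, g y ∂μ ≤ ∫⁻ y in cell idx i x, (1 + g y ^ s) ∂μ := by
              refine lintegral_mono fun y => ?_
              rcases le_total (g y) 1 with hy | hy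
              · exact hy.trans le_self_add
              · exact le_add_self.trans' (ENNReal.le_rpow_self_of_one_le hy hs.le)
          _ = m + ∫⁻ y in cell idx i x, g y ^ s ∂μ := by
              rw [lintegral_add_left measurable_const, setLIntegral_const, one_mul]
          _ ≤ _ := by
              gcongr
              exact Measure.restrict_le_self
      obtain ⟨j, hj1, hj2⟩ := exists_two_rpow_lt_le
        (ENNReal.div_pos hG0 (hμ i x)).ne' (ENNReal.div_ne_top hGtop hm0)
      rw [ENNReal.lt_div_iff_mul_lt (Or.inl hm0) (Or.inl (hμ i x))] at hj1
      rw [ENNReal.div_le_iff hm0 (hμ i x)] at hj2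
      have e1 : (2 : ℝ≥0∞) ^ (j : ℝ) = 2 * 2 ^ ((j - 1 : ℤ) : ℝ) := by
        rw [← ENNReal.rpow_one 2, ← ENNReal.rpow_mul, ← ENNReal.rpow_mul, ← two_rpow_add]
        push_cast; congr 1; ring
      have e2 : (2 : ℝ≥0∞) ^ ((j : ℝ) + 1) = 4 * 2 ^ ((j - 1 : ℤ) : ℝ) := by
        have : (4 : ℝ≥0∞) = 2 * 2 := by norm_num
        rw [two_rpow_add, e1, ENNReal.rpow_one, this]; ring
      rw [e1] at hj1
      rw [e2] at hj2
      have hsub : cell idx i x ⊆ Ω (j - 1) := fun y hy => by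
        refine ⟨i, ?_⟩
        rw [cell_eq hy]
        exact hj1
      have h2 : a i * G ≤ 4 * 2 ^ ((j - 1 : ℤ) : ℝ) * dyMax idx a (μ.restrict (Ω (j - 1))) x := by
        calc a i * G ≤ a i * (4 * 2 ^ ((j - 1 : ℤ) : ℝ) * m) := by gcongr
          _ = 4 * 2 ^ ((j - 1 : ℤ) : ℝ) * (a i * μ.restrict (Ω (j - 1)) (cell idx i x)) := by
              rw [Measure.restrict_apply (h.measurableSet_cell i x), inter_eq_left.2 hsub]
              ring
          _ ≤ _ := by
              gcongr
              exact le_iSup (fun i => a i * μ.restrict (Ω (j - 1)) (cell idx i x)) i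
      refine h2.trans ?_
      rw [one_div, ENNReal.le_rpow_inv_iff hr0]
      refine le_trans (le_of_eq ?_) (ENNReal.le_tsum (j - 1))
      rw [ENNReal.mul_rpow_of_nonneg _ _ hr0.le, ENNReal.mul_rpow_of_nonneg _ _ hr0.le,
        ← ENNReal.rpow_mul]
    calc _ ≤ ((∑' k : ℤ, (4 ^ r * (2 : ℝ≥0∞) ^ (k * r)) *
          dyMax idx a (μ.restrict (Ω k)) x ^ r) ^ (1 / r)) ^ r := by gcongr
      _ = _ := by rw [← ENNReal.rpow_mul, one_div_mul_cancel hr0.ne', ENNReal.rpow_one]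
  calc _ ≤ ∫⁻ x, ∑' k : ℤ, (4 ^ r * (2 : ℝ≥0∞) ^ (k * r)) *
        dyMax idx a (μ.restrict (Ω k)) x ^ r ∂ν := lintegral_mono hpt
    _ = ∑' k : ℤ, (4 ^ r * (2 : ℝ≥0∞) ^ (k * r)) *
          ∫⁻ x, dyMax idx a (μ.restrict (Ω k)) x ^ r ∂ν := by
        have hM : ∀ k, Measurable fun x => dyMax idx a (μ.restrict (Ω k)) x ^ r :=
          fun k => (h.measurable_dyMax _ _).pow_const _
        rw [lintegral_tsum fun k => ((hM k).const_mul _).aemeasurable]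
        exact tsum_congr fun k => lintegral_const_mul _ (hM k)
    _ ≤ ∑' k : ℤ, (4 ^ r * A) * ((2 : ℝ≥0∞) ^ (k * s) * μ (Ω k)) ^ (r / s) := by
        refine ENNReal.tsum_le_tsum fun k => ?_
        have e : (k * r : ℝ) = k * s * (r / s) := by field_simp
        rw [ENNReal.mul_rpow_of_nonneg _ _ (by positivity), ← ENNReal.rpow_mul, ← e]
        calc _ ≤ (4 ^ r * (2 : ℝ≥0∞) ^ (k * r)) * (A * μ (Ω k) ^ (r / s)) := by
              gcongr
              exact hA _ (hΩmeas k) (hΩfin k)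
          _ = _ := by ring
    _ ≤ (4 ^ r * A) * (∑' k : ℤ, (2 : ℝ≥0∞) ^ (k * s) * μ (Ω k)) ^ (r / s) := by
        rw [ENNReal.tsum_mul_left]
        gcongr
        exact ENNReal.tsum_rpow_le_rpow_tsum _ ((one_le_div hs0).2 hsr)
    _ ≤ (4 ^ r * A) * (geomConst (s - 1) * ∫⁻ x, g x ^ s ∂μ) ^ (r / s) := by
        gcongr
    _ = _ := by
        rw [ENNReal.mul_rpow_of_nonneg _ _ (by positivity)]
        ring

end IsRefining

open Classical in
/-- The part of the maximal operator that uses the cells of measure comparable to `τ`. -/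
def dyLevel (idx : ℕ → X → ι) (a : ℕ → ℝ≥0∞) (m : Measure X) (τ : ℝ≥0∞) (x : X) : ℝ≥0∞ :=
  ⨆ i, if τ < 2 * m (cell idx i x) ∧ m (cell idx i x) ≤ τ then a i * m (cell idx i x) else 0

/-- The constant in the comparison of `dySum` with `dyMax`. -/
def sumConst (β r s : ℝ) : ℝ≥0∞ :=
  geomConst ((r / s - 1) / (2 * r)) ^ r * ((2 * geomConst β) ^ r * geomConst ((r / s - 1) / 2))

lemma sumConst_ne_top {β r s : ℝ} (hβ : 0 < β) (hs : 0 < s) (hsr : s < r) :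
    sumConst β r s ≠ ∞ := by
  have hr : 0 < r := hs.trans hsr
  have h : 0 < r / s - 1 := sub_pos.2 ((one_lt_div hs).2 hsr)
  have h1 : geomConst ((r / s - 1) / (2 * r)) ≠ ∞ := geomConst_ne_top (by positivity)
  have h2 : geomConst β ≠ ∞ := geomConst_ne_top hβ
  have h3 : geomConst ((r / s - 1) / 2) ≠ ∞ := geomConst_ne_top (by positivity)
  exact ENNReal.mul_ne_top (ENNReal.rpow_ne_top_of_nonneg hr.le h1) (ENNReal.mul_ne_top
    (ENNReal.rpow_ne_top_of_nonneg hr.le (ENNReal.mul_ne_top ENNReal.ofNat_ne_top h2)) h3)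

lemma dySum_le_tsum_dyLevel {idx : ℕ → X → ι} {a : ℕ → ℝ≥0∞} {β : ℝ}
    (ha : ∀ i, a i ≤ 2 ^ (-β) * a (i + 1)) (m : Measure X) [IsFiniteMeasure m] (x : X) :
    dySum idx a m x ≤
      ∑' j : ℕ, 2 * geomConst β * dyLevel idx a m (m univ * 2 ^ (-(j : ℝ))) x := by
  classical
  set M := m univ
  set w : ℕ → ℝ≥0∞ := fun i => m (cell idx i x)
  set S : ℕ → Set ℕ := fun j => {i | M * 2 ^ (-(j : ℝ)) < 2 * w i ∧ w i ≤ M * 2 ^ (-(j : ℝ))}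
  have hex : ∀ i, w i ≠ 0 → ∃ j, i ∈ S j := fun i hi => by
    have hwM : w i ≤ M := measure_mono (subset_univ _)
    have hM0 : M ≠ 0 := fun h0 => hi (le_antisymm (hwM.trans h0.le) zero_le)
    have hMt : M ≠ ∞ := measure_ne_top _ _
    have hw : w i ≠ ∞ := measure_ne_top _ _
    obtain ⟨j, h1, h2⟩ := exists_two_rpow_lt_le
      (ENNReal.div_pos hi hMt).ne' (ENNReal.div_ne_top hw hM0)
    have hj : (j : ℝ) < (0 : ℤ) := by
      push_cast
      refine two_rpow_lt_two_rpow (h1.trans_le ?_)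
      rw [ENNReal.rpow_zero]
      exact ENNReal.div_le_of_le_mul (by rwa [one_mul])
    have hj' : j < 0 := by exact_mod_cast hj
    obtain ⟨n, hn⟩ : ∃ n : ℕ, (n : ℤ) = -(j + 1) :=
      ⟨(-(j + 1)).toNat, Int.toNat_of_nonneg (by omega)⟩
    have e : -(n : ℝ) = (j : ℝ) + 1 := by
      have h3 : ((n : ℤ) : ℝ) = ((-(j + 1) : ℤ) : ℝ) := by rw [hn]
      push_cast at h3
      linarith
    rw [ENNReal.lt_div_iff_mul_lt (Or.inl hM0) (Or.inl hMt)] at h1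
    rw [ENNReal.div_le_iff hM0 hMt] at h2
    refine ⟨n, ?_, ?_⟩
    · rw [e, two_rpow_add, ENNReal.rpow_one]
      calc _ = 2 * (2 ^ (j : ℝ) * M) := by ring
        _ < _ := ENNReal.mul_lt_mul_right (by norm_num) (by norm_num) h1
    · rwa [e, mul_comm]
  calc dySum idx a m x ≤ ∑' i, ∑' j, (if i ∈ S j then a i * w i else 0) := by
        refine ENNReal.tsum_le_tsum fun i => ?_
        change a i * w i ≤ _
        rcases eq_or_ne (w i) 0 with h0 | h0
        · simp [h0]
        obtain ⟨j, hj⟩ := hex i h0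
        refine le_trans ?_ (ENNReal.le_tsum j)
        rw [if_pos hj]
    _ = ∑' j, ∑' i, (if i ∈ S j then a i * w i else 0) := ENNReal.tsum_comm
    _ ≤ _ := by
        refine ENNReal.tsum_le_tsum fun j => ?_
        set τ := M * 2 ^ (-(j : ℝ))
        calc ∑' i, (if i ∈ S j then a i * w i else 0)
            ≤ ∑' i, τ * (if i ∈ S j then a i else 0) := by
              refine ENNReal.tsum_le_tsum fun i => ?_
              split_ifs with hi
              · rw [mul_comm]
                gcongr
                exact hi.2
              · exact zero_le
          _ ≤ τ * (geomConst β * ⨆ i ∈ S j, a i) := by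
              rw [ENNReal.tsum_mul_left]
              gcongr
              exact tsum_geometric_le_iSup ha _
          _ = geomConst β * ⨆ i ∈ S j, τ * a i := by
              simp only [← ENNReal.mul_iSup]
              ring
          _ ≤ geomConst β * (2 * dyLevel idx a m τ x) := by
              refine mul_le_mul_right (iSup₂_le fun i hi => ?_) _
              calc τ * a i ≤ 2 * w i * a i := by
                    gcongr
                    exact hi.1.le
                _ = 2 * (a i * w i) := by ring
                _ ≤ _ := by
                    gcongr
                    exact (if_pos hi).ge.trans (le_iSup (fun i => if τ < 2 * w i ∧ w i ≤ τ
                      then a i * w i else 0) i)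
          _ = _ := by ring

namespace IsRefining

variable {idx : ℕ → X → ι} (h : IsRefining idx)
include h

lemma measurable_dyLevel (a : ℕ → ℝ≥0∞) (m : Measure X) (τ : ℝ≥0∞) :
    Measurable (dyLevel idx a m τ) := by
  classical
  have hm := h.measurable_measure_cell m
  refine Measurable.iSup fun i => Measurable.ite ?_ ((hm i).const_mul _) measurable_const
  exact (measurableSet_lt measurable_const ((hm i).const_mul _)).inter
    (measurableSet_le (hm i) measurable_const)

lemma lintegral_dyLevel_rpow_le {a : ℕ → ℝ≥0∞} {m ν : Measure X} [IsFiniteMeasure m] {r t : ℝ}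
    (hr : 0 < r) (ht : 1 ≤ t) {A : ℝ≥0∞}
    (hA : ∀ F, MeasurableSet F → ∫⁻ x, dyMax idx a (m.restrict F) x ^ r ∂ν ≤ A * m F ^ t)
    (τ : ℝ≥0∞) :
    ∫⁻ x, dyLevel idx a m τ x ^ r ∂ν ≤ A * (τ ^ (t - 1) * m univ) := by
  classical
  set P : ℕ → X → Prop := fun i x => m (cell idx i x) ≤ τ with hPdef
  have hP : ∀ i x y, idx i x = idx i y → (P i x ↔ P i y) := fun i x y hxy => by
    simp only [P, cell_eq hxy]
  have hmeas := h.measurableSet_firstHit hP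
  have hzero : ∀ x, x ∉ ⋃ c, firstHit idx P c → dyLevel idx a m τ x ^ r = 0 := fun x hx => by
    rw [iUnion_firstHit] at hx
    have : dyLevel idx a m τ x = 0 := by
      refine le_antisymm (iSup_le fun i => ?_) zero_le
      rw [if_neg fun hi => hx ⟨i, hi.2⟩]
    rw [this, ENNReal.zero_rpow_of_pos hr]
  have hpt : ∀ c, ∀ x ∈ firstHit idx P c,
      dyLevel idx a m τ x ≤ dyMax idx a (m.restrict (firstHit idx P c)) x := by
    intro c x hx
    refine iSup_le fun i => ?_
    split_ifs with hi
    · refine le_trans (le_of_eq ?_)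
        (le_iSup (fun i => a i * m.restrict (firstHit idx P c) (cell idx i x)) i)
      have hci : c.1 ≤ i := by
        by_contra! hc
        exact hx.2.2 i hc hi.2
      rw [Measure.restrict_apply (h.measurableSet_cell i x), inter_eq_left.2]
      rw [h.firstHit_eq_cell hP hx]
      exact h.cell_subset hci x
    · exact zero_le
  calc ∫⁻ x, dyLevel idx a m τ x ^ r ∂ν
      = ∫⁻ x in ⋃ c, firstHit idx P c, dyLevel idx a m τ x ^ r ∂ν := by
        rw [← lintegral_indicator (MeasurableSet.iUnion hmeas)]
        refine lintegral_congr fun x => ?_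
        by_cases hx : x ∈ ⋃ c, firstHit idx P c
        · rw [indicator_of_mem hx]
        · rw [indicator_of_notMem hx, hzero x hx]
    _ ≤ ∑' c, ∫⁻ x in firstHit idx P c, dyLevel idx a m τ x ^ r ∂ν := lintegral_iUnion_le _ _
    _ ≤ ∑' c, A * (τ ^ (t - 1) * m (firstHit idx P c)) := by
        refine ENNReal.tsum_le_tsum fun c => ?_
        calc _ ≤ ∫⁻ x in firstHit idx P c,
              dyMax idx a (m.restrict (firstHit idx P c)) x ^ r ∂ν :=
              setLIntegral_mono' (hmeas c) fun x hx => ENNReal.rpow_le_rpow (hpt c x hx) hr.le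
          _ ≤ A * m (firstHit idx P c) ^ t :=
              (setLIntegral_le_lintegral _ _).trans (hA _ (hmeas c))
          _ ≤ _ := by
              gcongr
              have hle : m (firstHit idx P c) ≤ τ := by
                rcases (firstHit idx P c).eq_empty_or_nonempty with h0 | ⟨x, hx⟩
                · simp [h0]
                · rw [h.firstHit_eq_cell hP hx]
                  exact hx.2.1
              have := ENNReal.rpow_add_of_nonneg (x := m (firstHit idx P c)) (t - 1) 1
                (by linarith) (by norm_num)
              rw [sub_add_cancel, ENNReal.rpow_one] at this
              rw [this]
              exact mul_le_mul_left (ENNReal.rpow_le_rpow hle (by linarith)) _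
    _ ≤ _ := by
        rw [ENNReal.tsum_mul_left, ENNReal.tsum_mul_left]
        gcongr
        exact tsum_measure_le_measure_univ (fun c => (hmeas c).nullMeasurableSet)
          (fun c d hcd => (pairwise_disjoint_firstHit hcd).aedisjoint)

/-- If the maximal operator is bounded on indicator functions with an off-diagonal gain, so is
the corresponding positive operator. -/
lemma lintegral_dySum_rpow_le {a : ℕ → ℝ≥0∞} {β : ℝ} (ha : ∀ i, a i ≤ 2 ^ (-β) * a (i + 1))
    {m ν : Measure X} [IsFiniteMeasure m] {r s : ℝ} (hs : 0 < s) (hsr : s < r) {A : ℝ≥0∞}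
    (hA : ∀ F, MeasurableSet F → ∫⁻ x, dyMax idx a (m.restrict F) x ^ r ∂ν ≤ A * m F ^ (r / s)) :
    ∫⁻ x, dySum idx a m x ^ r ∂ν ≤ sumConst β r s * (A * m univ ^ (r / s)) := by
  have hr : 0 < r := hs.trans hsr
  have h1 : 1 < r / s := (one_lt_div hs).2 hsr
  set γ := r / s - 1 with hγ
  have hγ0 : 0 < γ := by linarith
  set δ := γ / (2 * r) with hδ
  set M := m univ
  have hpt : ∀ x, dySum idx a m x ^ r ≤ geomConst δ ^ r * ∑' j : ℕ,
      ((2 * geomConst β) ^ r * 2 ^ (γ / 2 * j)) *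
        dyLevel idx a m (M * 2 ^ (-(j : ℝ))) x ^ r := by
    intro x
    calc _ ≤ (∑' j : ℕ, 2 * geomConst β * dyLevel idx a m (M * 2 ^ (-(j : ℝ))) x) ^ r := by
          gcongr
          exact dySum_le_tsum_dyLevel ha m x
      _ ≤ (∑' j : ℕ, ((2 : ℝ≥0∞) ^ (-δ)) ^ j) ^ r * ∑' j : ℕ,
          (2 * geomConst β * 2 ^ (δ * j) * dyLevel idx a m (M * 2 ^ (-(j : ℝ))) x) ^ r := by
          refine ENNReal.rpow_tsum_le (fun j => le_of_eq ?_) hr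
          rw [← two_rpow_neg_mul_natCast]
          calc _ = ((2 : ℝ≥0∞) ^ (-(δ * j)) * 2 ^ (δ * j)) *
                (2 * geomConst β * dyLevel idx a m (M * 2 ^ (-(j : ℝ))) x) := by
                rw [← two_rpow_add, neg_add_cancel, ENNReal.rpow_zero, one_mul]
            _ = _ := by ring
      _ = _ := by
          rw [tsum_two_rpow_neg_pow]
          congr 1
          refine tsum_congr fun j => ?_
          have e : δ * j * r = γ / 2 * j := by rw [hδ]; field_simp
          rw [ENNReal.mul_rpow_of_nonneg _ _ hr.le, ENNReal.mul_rpow_of_nonneg _ _ hr.le,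
            ← ENNReal.rpow_mul, e]
  have hL : ∀ j : ℕ, Measurable fun x => dyLevel idx a m (M * 2 ^ (-(j : ℝ))) x ^ r :=
    fun j => (h.measurable_dyLevel _ _ _).pow_const _
  calc _ ≤ ∫⁻ x, geomConst δ ^ r * ∑' j : ℕ, ((2 * geomConst β) ^ r * 2 ^ (γ / 2 * j)) *
        dyLevel idx a m (M * 2 ^ (-(j : ℝ))) x ^ r ∂ν := lintegral_mono hpt
    _ = geomConst δ ^ r * ∑' j : ℕ, ((2 * geomConst β) ^ r * 2 ^ (γ / 2 * j)) *
        ∫⁻ x, dyLevel idx a m (M * 2 ^ (-(j : ℝ))) x ^ r ∂ν := by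
        rw [lintegral_const_mul _ (Measurable.tsum fun j => (hL j).const_mul _),
          lintegral_tsum fun j => ((hL j).const_mul _).aemeasurable]
        congr 1
        exact tsum_congr fun j => lintegral_const_mul _ (hL j)
    _ ≤ geomConst δ ^ r * ∑' j : ℕ, ((2 * geomConst β) ^ r * (A * M ^ (r / s))) *
        ((2 : ℝ≥0∞) ^ (-(γ / 2))) ^ j := by
        refine mul_le_mul_right (ENNReal.tsum_le_tsum fun j => ?_) _
        calc _ ≤ ((2 * geomConst β) ^ r * 2 ^ (γ / 2 * j)) *
              (A * ((M * 2 ^ (-(j : ℝ))) ^ (r / s - 1) * M)) := by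
              gcongr
              exact h.lintegral_dyLevel_rpow_le hr h1.le hA _
          _ = ((2 * geomConst β) ^ r * (A * (M ^ γ * M))) *
              (2 ^ (γ / 2 * j) * 2 ^ (-(j : ℝ) * γ)) := by
              rw [ENNReal.mul_rpow_of_nonneg _ _ hγ0.le, ← ENNReal.rpow_mul]
              ring
          _ = _ := by
              have e1 := ENNReal.rpow_add_of_nonneg (x := M) γ 1 hγ0.le (by norm_num)
              rw [hγ, sub_add_cancel, ENNReal.rpow_one, ← hγ] at e1
              have e2 : γ / 2 * j + -(j : ℝ) * γ = -(γ / 2 * j) := by ring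
              rw [← e1, ← two_rpow_add, e2, two_rpow_neg_mul_natCast]
    _ = _ := by
        rw [ENNReal.tsum_mul_left, tsum_two_rpow_neg_pow, sumConst]
        ring

end IsRefining

end Refining

section Grid

/-- The shift of the grid of generation `k`: alternately `1/3` and `-1/3`, or no shift at all. -/
def gridShift (e : Bool) (k : ℤ) : ℝ := if e then (-1) ^ k / 3 else 0

lemma gridShift_true_eq (k : ℤ) : gridShift true k = 1 / 3 ∨ gridShift true k = -1 / 3 := by
  rcases Int.even_or_odd k with hk | hk
  · simp [gridShift, hk.neg_one_zpow]
  · simp [gridShift, hk.neg_one_zpow]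

lemma gridShift_succ (e : Bool) (k : ℤ) : gridShift e (k + 1) = -gridShift e k := by
  cases e
  · simp [gridShift]
  · simp only [gridShift, if_true]
    rw [zpow_add_one₀ (by norm_num)]
    ring

lemma exists_three_mul_gridShift (e : Bool) (k : ℤ) : ∃ z : ℤ, 3 * gridShift e k = z := by
  cases e
  · exact ⟨0, by simp [gridShift]⟩
  · rcases gridShift_true_eq k with h | h
    · exact ⟨1, by rw [h]; norm_num⟩
    · exact ⟨-1, by rw [h]; norm_num⟩

lemma floor_grid_succ (e : Bool) (k : ℤ) {x y : ℝ}
    (h : ⌊x / 2 ^ k - gridShift e k⌋ = ⌊y / 2 ^ k - gridShift e k⌋) :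
    ⌊x / 2 ^ (k + 1) - gridShift e (k + 1)⌋ = ⌊y / 2 ^ (k + 1) - gridShift e (k + 1)⌋ := by
  obtain ⟨z, hz⟩ := exists_three_mul_gridShift e k
  have key : ∀ t : ℝ, ⌊t / 2 ^ (k + 1) - gridShift e (k + 1)⌋ =
      (⌊t / 2 ^ k - gridShift e k⌋ + z) / ((2 : ℕ) : ℤ) := fun t => by
    have : t / 2 ^ (k + 1) - gridShift e (k + 1) =
        ((t / 2 ^ k - gridShift e k) + (z : ℝ)) / ((2 : ℕ) : ℝ) := by
      rw [gridShift_succ, ← hz, zpow_add_one₀ (by norm_num)]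
      push_cast
      field_simp
      ring
    rw [this, Int.floor_div_natCast, Int.floor_add_intCast]
  rw [key, key, h]

lemma exists_floor_sub_gridShift_eq (k : ℤ) {a b : ℝ} (hab : a ≤ b) (h : b - a < 1 / 3) :
    ∃ e, ⌊a - gridShift e k⌋ = ⌊b - gridShift e k⌋ := by
  by_contra! hc
  have hlt : ∀ e, ∃ z : ℤ, a - gridShift e k < z ∧ (z : ℝ) ≤ b - gridShift e k := fun e => by
    refine ⟨⌊b - gridShift e k⌋, ?_, Int.floor_le _⟩
    rw [← Int.floor_lt]
    exact lt_of_le_of_ne (Int.floor_le_floor (by linarith)) (hc e)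
  obtain ⟨z, hz1, hz2⟩ := hlt false
  obtain ⟨w, hw1, hw2⟩ := hlt true
  simp only [gridShift, Bool.false_eq_true, if_false, sub_zero] at hz1 hz2
  rcases gridShift_true_eq k with hs | hs <;> rw [hs] at hw1 hw2
  · have h1 : (z : ℝ) - w < 1 := by linarith
    have h2 : (0 : ℝ) < (z : ℝ) - w := by linarith
    have h3 : z - w < 1 := by exact_mod_cast h1
    have h4 : 0 < z - w := by exact_mod_cast h2
    omega
  · have h1 : (w : ℝ) - z < 1 := by linarith
    have h2 : (0 : ℝ) < (w : ℝ) - z := by linarith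
    have h3 : w - z < 1 := by exact_mod_cast h1
    have h4 : 0 < w - z := by exact_mod_cast h2
    omega

variable {n : ℕ}

/-- The index of the cell of generation `k` of the grid with shift pattern `ε`. -/
def gridIdx (ε : Fin n → Bool) (k : ℤ) (x : Rn n) : Fin n → ℤ :=
  fun d => ⌊x d / 2 ^ k - gridShift (ε d) k⌋

/-- The cell of generation `k` that contains `x`. -/
def gridCell (ε : Fin n → Bool) (k : ℤ) (x : Rn n) : Set (Rn n) :=
  {y | gridIdx ε k y = gridIdx ε k x}

/-- The cube whose set is `gridCell ε k x`. -/
def gridCube (ε : Fin n → Bool) (k : ℤ) (x : Rn n) : Cube n where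
  corner d := 2 ^ k * (gridIdx ε k x d + gridShift (ε d) k)
  side := 2 ^ k
  side_pos := by positivity

lemma gridCube_set (ε : Fin n → Bool) (k : ℤ) (x : Rn n) :
    (gridCube ε k x).set = gridCell ε k x := by
  ext y
  simp only [Cube.set, gridCell, gridCube, mem_ofPred_eq, funext_iff]
  refine forall_congr' fun d => ?_
  have h2 : (0 : ℝ) < 2 ^ k := by positivity
  generalize gridIdx ε k x d = v
  rw [gridIdx, Int.floor_eq_iff, le_sub_iff_add_le, sub_lt_iff_lt_add, le_div_iff₀ h2,
    div_lt_iff₀ h2]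
  refine and_congr ?_ ?_
  · rw [mul_comm]
  · have : (2 : ℝ) ^ k * (v + gridShift (ε d) k) + 2 ^ k = (v + 1 + gridShift (ε d) k) * 2 ^ k := by
      ring
    rw [this]

lemma exists_forall_gridIdx_eq (k : ℤ) {a b : Rn n} (hab : ∀ d, a d ≤ b d)
    (h : ∀ d, 3 * (b d - a d) < 2 ^ k) :
    ∃ ε, ∀ x : Rn n, (∀ d, a d ≤ x d ∧ x d ≤ b d) → gridIdx ε k x = gridIdx ε k a := by
  have h2 : (0 : ℝ) < 2 ^ k := by positivity
  have hd : ∀ d, ∃ e, ⌊a d / 2 ^ k - gridShift e k⌋ = ⌊b d / 2 ^ k - gridShift e k⌋ := fun d => by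
    refine exists_floor_sub_gridShift_eq k (by gcongr; exact hab d) ?_
    rw [← sub_div, div_lt_iff₀ h2]
    linarith [h d]
  choose ε hε using hd
  refine ⟨ε, fun x hx => funext fun d => le_antisymm ?_ ?_⟩
  · calc ⌊x d / 2 ^ k - gridShift (ε d) k⌋ ≤ ⌊b d / 2 ^ k - gridShift (ε d) k⌋ := by
          gcongr; exact (hx d).2
      _ = _ := (hε d).symm
  · change ⌊a d / 2 ^ k - gridShift (ε d) k⌋ ≤ ⌊x d / 2 ^ k - gridShift (ε d) k⌋
    gcongr
    exact (hx d).1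

lemma measurable_gridIdx (ε : Fin n → Bool) (k : ℤ) : Measurable (gridIdx ε k) :=
  measurable_pi_lambda _ fun d =>
    Int.measurable_floor.comp (((measurable_pi_apply d).div_const _).sub_const _)

lemma isRefining_grid (ε : Fin n → Bool) (K : ℤ) :
    IsRefining fun (i : ℕ) => gridIdx ε (K - i) where
  measurable i := measurable_gridIdx ε _
  refine i x y h := funext fun d => by
    have h1 := congrFun h d
    have h2 := floor_grid_succ (ε d) _ h1
    have e : K - ((i + 1 : ℕ) : ℤ) + 1 = K - i := by push_cast; ring
    rwa [e] at h2

/-- The dyadic fractional maximal operator of a grid, applied to a measure. -/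
def gridMax (ε : Fin n → Bool) (β : ℝ) (m : Measure (Rn n)) (x : Rn n) : ℝ≥0∞ :=
  ⨆ k : ℤ, 2 ^ (-(β * k)) * m (gridCell ε k x)

/-- The dyadic fractional integral operator of a grid, applied to a measure. -/
def gridSum (ε : Fin n → Bool) (β : ℝ) (m : Measure (Rn n)) (x : Rn n) : ℝ≥0∞ :=
  ∑' k : ℤ, 2 ^ (-(β * k)) * m (gridCell ε k x)

/-- The coefficients of the dyadic operators restricted to generations at most `K`. -/
def gridCoeff (β : ℝ) (K : ℤ) (i : ℕ) : ℝ≥0∞ := 2 ^ (-(β * (K - i : ℤ)))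

lemma gridCoeff_le (β : ℝ) (K : ℤ) (i : ℕ) :
    gridCoeff β K i ≤ 2 ^ (-β) * gridCoeff β K (i + 1) := by
  rw [gridCoeff, gridCoeff, ← two_rpow_add]
  refine le_of_eq (congrArg _ ?_)
  push_cast
  ring

lemma dyMax_grid_le (ε : Fin n → Bool) (β : ℝ) (K : ℤ) (m : Measure (Rn n)) (x : Rn n) :
    dyMax (fun (i : ℕ) => gridIdx ε (K - i)) (gridCoeff β K) m x ≤ gridMax ε β m x :=
  iSup_le fun i => le_iSup (fun k : ℤ => (2 : ℝ≥0∞) ^ (-(β * k)) * m (gridCell ε k x)) (K - i)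

lemma lintegral_gridMax_rpow_le {ε : Fin n → Bool} {β : ℝ} {m ν : Measure (Rn n)} {r : ℝ}
    (hr : 0 < r) {D : ℝ≥0∞}
    (hD : ∀ K : ℕ, ∫⁻ x, dyMax (fun (i : ℕ) => gridIdx ε (K - i)) (gridCoeff β K) m x ^ r ∂ν ≤ D) :
    ∫⁻ x, gridMax ε β m x ^ r ∂ν ≤ D := by
  set F : ℕ → Rn n → ℝ≥0∞ := fun K x =>
    dyMax (fun (i : ℕ) => gridIdx ε (K - i)) (gridCoeff β K) m x ^ r
  have hmono : Monotone F := monotone_nat_of_le_succ fun K x => by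
    refine ENNReal.rpow_le_rpow (iSup_le fun i => ?_) hr.le
    refine le_trans (le_of_eq ?_) (le_iSup _ (i + 1))
    have e : ((K + 1 : ℕ) : ℤ) - ((i + 1 : ℕ) : ℤ) = K - i := by push_cast; ring
    simp only [gridCoeff, cell, e]
  have hle : ∀ x, gridMax ε β m x ^ r ≤ ⨆ K, F K x := fun x => by
    rw [← ENNReal.le_rpow_inv_iff hr]
    refine iSup_le fun k => ?_
    rw [ENNReal.le_rpow_inv_iff hr]
    refine le_trans (ENNReal.rpow_le_rpow ?_ hr.le) (le_iSup (fun K => F K x) k.toNat)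
    refine le_trans (le_of_eq ?_) (le_iSup _ (k.toNat - k).toNat)
    have e : (k.toNat : ℤ) - (((k.toNat : ℤ) - k).toNat : ℤ) = k := by omega
    simp only [gridCoeff, cell, e, gridCell]
  calc _ ≤ ∫⁻ x, ⨆ K, F K x ∂ν := lintegral_mono hle
    _ = ⨆ K, ∫⁻ x, F K x ∂ν :=
        lintegral_iSup (fun K => ((isRefining_grid ε K).measurable_dyMax _ _).pow_const _) hmono
    _ ≤ D := iSup_le hD

lemma lintegral_gridSum_rpow_le_of_forall {ε : Fin n → Bool} {β : ℝ} {m ν : Measure (Rn n)} {r : ℝ}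
    (hr : 0 < r) {D : ℝ≥0∞}
    (hD : ∀ K : ℕ, ∫⁻ x, dySum (fun (i : ℕ) => gridIdx ε (K - i)) (gridCoeff β K) m x ^ r ∂ν ≤ D) :
    ∫⁻ x, gridSum ε β m x ^ r ∂ν ≤ D := by
  set F : ℕ → Rn n → ℝ≥0∞ := fun K x =>
    dySum (fun (i : ℕ) => gridIdx ε (K - i)) (gridCoeff β K) m x ^ r
  have hmono : Monotone F := monotone_nat_of_le_succ fun K x => by
    refine ENNReal.rpow_le_rpow ?_ hr.le
    refine le_trans (le_of_eq (tsum_congr fun i => ?_))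
      (ENNReal.tsum_comp_le_tsum_of_injective Nat.succ_injective _)
    have e : ((K + 1 : ℕ) : ℤ) - ((i.succ : ℕ) : ℤ) = K - i := by push_cast; ring
    simp only [gridCoeff, cell, e]
  have hle : ∀ x, gridSum ε β m x ^ r ≤ ⨆ K, F K x := fun x => by
    rw [← ENNReal.le_rpow_inv_iff hr, gridSum, ENNReal.tsum_eq_iSup_sum]
    refine iSup_le fun S => ?_
    rw [ENNReal.le_rpow_inv_iff hr]
    obtain ⟨K, hK⟩ : ∃ K : ℕ, ∀ k ∈ S, k ≤ K :=
      ⟨S.sup Int.toNat, fun k hk => (Int.self_le_toNat k).trans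
        (by exact_mod_cast Finset.le_sup (f := Int.toNat) hk)⟩
    refine le_trans (ENNReal.rpow_le_rpow ?_ hr.le) (le_iSup (fun K => F K x) K)
    have hinj : Set.InjOn (fun k : ℤ => (K - k).toNat) S := fun a ha b hb hab => by
      have := hK a ha
      have := hK b hb
      simp only at hab
      omega
    calc ∑ k ∈ S, (2 : ℝ≥0∞) ^ (-(β * k)) * m (gridCell ε k x)
        = ∑ i ∈ S.image (fun k : ℤ => (K - k).toNat), gridCoeff β K i *
          m (cell (fun (i : ℕ) => gridIdx ε (K - i)) i x) := by
          rw [Finset.sum_image hinj]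
          refine Finset.sum_congr rfl fun k hk => ?_
          have e : (K : ℤ) - (((K : ℤ) - k).toNat : ℤ) = k := by
            have := hK k hk
            omega
          simp only [gridCoeff, cell, e, gridCell]
      _ ≤ _ := ENNReal.sum_le_tsum _
  calc _ ≤ ∫⁻ x, ⨆ K, F K x ∂ν := lintegral_mono hle
    _ = ⨆ K, ∫⁻ x, F K x ∂ν :=
        lintegral_iSup (fun K => ((isRefining_grid ε K).measurable_dySum _ _).pow_const _) hmono
    _ ≤ D := iSup_le hD

lemma lintegral_gridMax_withDensity_rpow_le {ε : Fin n → Bool} {β : ℝ} {μ ν : Measure (Rn n)}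
    {s r : ℝ} (hs : 1 < s) (hsr : s ≤ r) (hμ : ∀ Q : Cube n, μ Q.set ≠ ∞) {A : ℝ≥0∞}
    (hA : ∀ E, MeasurableSet E → μ E ≠ ∞ →
      ∫⁻ x, gridMax ε β (μ.restrict E) x ^ r ∂ν ≤ A * μ E ^ (r / s))
    {g : Rn n → ℝ≥0∞} (hg : Measurable g) (hgs : ∫⁻ x, g x ^ s ∂μ ≠ ∞) :
    ∫⁻ x, gridMax ε β (μ.withDensity g) x ^ r ∂ν ≤
      4 ^ r * geomConst (s - 1) ^ (r / s) * A * (∫⁻ x, g x ^ s ∂μ) ^ (r / s) := by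
  refine lintegral_gridMax_rpow_le (by linarith) fun K => ?_
  refine (isRefining_grid ε K).lintegral_dyMax_rpow_le hs hsr (fun i x => ?_) (fun E hE hE' => ?_)
    hg hgs
  · have := hμ (gridCube ε (K - i) x)
    rwa [gridCube_set] at this
  · refine le_trans (lintegral_mono fun x => ?_) (hA E hE hE')
    exact ENNReal.rpow_le_rpow (dyMax_grid_le _ _ _ _ _) (by linarith)

lemma lintegral_gridSum_rpow_le {ε : Fin n → Bool} {β : ℝ} {m ν : Measure (Rn n)}
    [IsFiniteMeasure m] {r s : ℝ} (hs : 0 < s) (hsr : s < r) {A : ℝ≥0∞}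
    (hA : ∀ F, MeasurableSet F →
      ∫⁻ x, gridMax ε β (m.restrict F) x ^ r ∂ν ≤ A * m F ^ (r / s)) :
    ∫⁻ x, gridSum ε β m x ^ r ∂ν ≤ sumConst β r s * (A * m univ ^ (r / s)) := by
  refine lintegral_gridSum_rpow_le_of_forall (by linarith) fun K => ?_
  refine (isRefining_grid ε K).lintegral_dySum_rpow_le (gridCoeff_le β K) hs hsr fun F hF => ?_
  refine le_trans (lintegral_mono fun x => ?_) (hA F hF)
  exact ENNReal.rpow_le_rpow (dyMax_grid_le _ _ _ _ _) (by linarith)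

end Grid

section Comparison

variable {n : ℕ} {α : ℝ}

lemma eucNorm_le_mul {z : Rn n} {b : ℝ} (hb : 0 ≤ b) (h : ∀ d, |z d| ≤ b) :
    eucNorm z ≤ n * b := by
  rw [eucNorm, Real.sqrt_le_left (by positivity)]
  calc ∑ d, z d ^ 2 ≤ ∑ _d : Fin n, b ^ 2 :=
        Finset.sum_le_sum fun d _ => sq_le_sq' (abs_le.1 (h d)).1 (abs_le.1 (h d)).2
    _ = n * b ^ 2 := by simp
    _ ≤ (n * b) ^ 2 := by
        rw [mul_pow]
        gcongr
        exact_mod_cast Nat.le_self_pow two_ne_zero n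

lemma abs_le_eucNorm (z : Rn n) (d : Fin n) : |z d| ≤ eucNorm z :=
  Real.abs_le_sqrt (Finset.single_le_sum (f := fun i => z i ^ 2) (fun i _ => sq_nonneg (z i))
    (Finset.mem_univ d))

lemma eucNorm_pos {z : Rn n} (hz : z ≠ 0) : 0 < eucNorm z := by
  obtain ⟨d, hd⟩ := Function.ne_iff.1 hz
  exact (abs_pos.2 hd).trans_le (abs_le_eucNorm z d)

lemma measurable_eucNorm : Measurable (eucNorm : Rn n → ℝ) :=
  (Finset.measurable_sum _ fun i _ => (measurable_pi_apply i).pow_const 2).sqrt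

/-- The kernel of the Riesz potential. -/
def rieszKer (α : ℝ) (x y : Rn n) : ℝ≥0∞ := ENNReal.ofReal (eucNorm (x - y) ^ (α - n))

lemma rieszKer_comm (x y : Rn n) : rieszKer α x y = rieszKer α y x := by
  have : eucNorm (x - y) = eucNorm (y - x) := by
    refine congrArg Real.sqrt (Finset.sum_congr rfl fun i _ => ?_)
    simp only [Pi.sub_apply]
    ring
  rw [rieszKer, rieszKer, this]

lemma measurable_rieszKer : Measurable fun z : Rn n × Rn n => rieszKer α z.1 z.2 :=
  ((measurable_eucNorm.comp (measurable_fst.sub measurable_snd)).pow_const _).ennreal_ofReal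

lemma rieszKer_self (hαn : α < n) (x : Rn n) : rieszKer α x x = 0 := by
  simp [rieszKer, eucNorm, Real.zero_rpow (sub_neg.2 hαn).ne]

lemma ofReal_two_zpow_rpow (k : ℤ) (t : ℝ) :
    ENNReal.ofReal (((2 : ℝ) ^ k) ^ t) = 2 ^ (t * k) := by
  rw [← Real.rpow_intCast, ← Real.rpow_mul (by norm_num), mul_comm,
    ← ENNReal.ofReal_rpow_of_pos (by norm_num)]
  simp

lemma measurableSet_gridCell (ε : Fin n → Bool) (k : ℤ) (x : Rn n) :
    MeasurableSet (gridCell ε k x) :=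
  measurable_gridIdx ε k (measurableSet_singleton (gridIdx ε k x))

lemma two_rpow_le_rieszKer (hn : 0 < n) (hαn : α < n) {ε : Fin n → Bool} {k : ℤ} {x y : Rn n}
    (hxy : y ≠ x) (h : y ∈ gridCell ε k x) :
    (2 : ℝ≥0∞) ^ (-((n - α) * k)) ≤ ENNReal.ofReal (n ^ (n - α)) * rieszKer α x y := by
  have h2 : (0 : ℝ) < 2 ^ k := by positivity
  have hn' : (0 : ℝ) < n := by exact_mod_cast hn
  have hle : eucNorm (x - y) ≤ n * 2 ^ k := by
    refine eucNorm_le_mul h2.le fun d => ?_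
    have h1 := Int.abs_sub_lt_one_of_floor_eq_floor (congrFun h d).symm
    rw [sub_sub_sub_cancel_right, ← sub_div, abs_div, abs_of_pos h2, div_lt_one h2] at h1
    exact h1.le
  rw [rieszKer, ← ENNReal.ofReal_mul (by positivity),
    show -(((n : ℝ) - α) * k) = (α - n) * k by ring, ← ofReal_two_zpow_rpow]
  refine ENNReal.ofReal_le_ofReal ?_
  calc ((2 : ℝ) ^ k) ^ (α - n) = n ^ (n - α) * (n * 2 ^ k) ^ (α - n) := by
        rw [Real.mul_rpow hn'.le h2.le, ← mul_assoc, ← Real.rpow_add hn']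
        simp
    _ ≤ _ := by
        gcongr ?_ * ?_
        exact Real.rpow_le_rpow_of_nonpos (eucNorm_pos (sub_ne_zero.2 hxy.symm)) hle (by linarith)

lemma gridMax_le_lintegral_rieszKer (hn : 0 < n) (hαn : α < n) (ε : Fin n → Bool)
    (m : Measure (Rn n)) [NullSingletonClass m] (x : Rn n) :
    gridMax ε (n - α) m x ≤ ENNReal.ofReal (n ^ (n - α)) * ∫⁻ y, rieszKer α x y ∂m := by
  refine iSup_le fun k => ?_
  have hne : ∀ᵐ y ∂m, y ≠ x := by
    rw [ae_iff]
    simp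
  rw [← setLIntegral_const, ← lintegral_const_mul _ measurable_rieszKer.of_uncurry_left]
  refine (lintegral_mono_ae ?_).trans (setLIntegral_le_lintegral (gridCell ε k x) _)
  filter_upwards [ae_restrict_mem (measurableSet_gridCell ε k x), ae_restrict_of_ae hne]
    with y hy hyx using two_rpow_le_rieszKer hn hαn hyx hy

lemma exists_gridIdx_eq_of_sub_le {a b : Rn n} (hab : ∀ d, a d ≤ b d) {L : ℝ} (hL : 0 < L)
    (h : ∀ d, b d - a d ≤ L) {β : ℝ} (hβ : 0 ≤ β) :
    ∃ (ε : Fin n → Bool) (k : ℤ),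
      (∀ x : Rn n, (∀ d, a d ≤ x d ∧ x d ≤ b d) → gridIdx ε k x = gridIdx ε k a) ∧
      ENNReal.ofReal (L ^ (-β)) ≤ ENNReal.ofReal (6 ^ β) * 2 ^ (-(β * k)) := by
  obtain ⟨j, hj1, hj2⟩ := exists_mem_Ico_zpow (x := 3 * L) (y := (2 : ℝ)) (by positivity)
    (by norm_num)
  obtain ⟨ε, hε⟩ := exists_forall_gridIdx_eq (j + 1) hab fun d =>
    lt_of_le_of_lt (by linarith [h d]) hj2
  refine ⟨ε, j + 1, hε, ?_⟩
  have h2 : (0 : ℝ) < 2 ^ (j + 1) := by positivity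
  rw [← neg_mul, ← ofReal_two_zpow_rpow, ← ENNReal.ofReal_mul (by positivity)]
  refine ENNReal.ofReal_le_ofReal ?_
  have hle : (2 : ℝ) ^ (j + 1) ≤ 6 * L := by
    rw [zpow_add_one₀ (by norm_num)]
    linarith
  calc L ^ (-β) = 6 ^ β * (6 * L) ^ (-β) := by
        rw [Real.mul_rpow (by norm_num) hL.le, ← mul_assoc, ← Real.rpow_add (by norm_num)]
        simp
    _ ≤ _ := by
        gcongr ?_ * ?_
        exact Real.rpow_le_rpow_of_nonpos h2 hle (by linarith)

lemma rieszKer_le_sum (hαn : α < n) (x y : Rn n) :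
    rieszKer α x y ≤ ENNReal.ofReal (6 ^ (n - α)) *
      ∑ ε, ∑' k : ℤ, (gridCell ε k x).indicator (fun _ => 2 ^ (-((n - α) * k))) y := by
  rcases eq_or_ne x y with rfl | hxy
  · simp [rieszKer_self hαn]
  obtain ⟨ε, k, hk, hle⟩ := exists_gridIdx_eq_of_sub_le (a := fun d => min (x d) (y d))
    (b := fun d => max (x d) (y d)) (fun d => min_le_max) (eucNorm_pos (sub_ne_zero.2 hxy))
    (fun d => (max_sub_min_eq_abs' _ _).trans_le (abs_le_eucNorm (x - y) d)) (sub_nonneg.2 hαn.le)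
  rw [neg_sub] at hle
  refine hle.trans ?_
  have hy : y ∈ gridCell ε k x :=
    (hk y fun d => ⟨min_le_right _ _, le_max_right _ _⟩).trans
      (hk x fun d => ⟨min_le_left _ _, le_max_left _ _⟩).symm
  gcongr
  calc (2 : ℝ≥0∞) ^ (-((n - α) * k))
      = (gridCell ε k x).indicator (fun _ => 2 ^ (-((n - α) * k))) y := by
        rw [indicator_of_mem hy]
    _ ≤ ∑' k : ℤ, (gridCell ε k x).indicator (fun _ => 2 ^ (-((n - α) * k))) y :=
        ENNReal.le_tsum k
    _ ≤ _ := Finset.single_le_sum (f := fun ε => ∑' k : ℤ,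
        (gridCell ε k x).indicator (fun _ => (2 : ℝ≥0∞) ^ (-((n - α) * k))) y)
        (fun _ _ => zero_le) (Finset.mem_univ ε)

lemma lintegral_rieszKer_le_sum (hαn : α < n) (m : Measure (Rn n)) (x : Rn n) :
    ∫⁻ y, rieszKer α x y ∂m ≤ ENNReal.ofReal (6 ^ (n - α)) * ∑ ε, gridSum ε (n - α) m x := by
  have hmeas : ∀ (ε : Fin n → Bool) (k : ℤ), Measurable
      ((gridCell ε k x).indicator fun _ => (2 : ℝ≥0∞) ^ (-((n - α) * k))) := fun ε k =>
    measurable_const.indicator (measurableSet_gridCell ε k x)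
  refine (lintegral_mono (rieszKer_le_sum hαn x)).trans (le_of_eq ?_)
  rw [lintegral_const_mul _ (Finset.measurable_sum _ fun ε _ => Measurable.tsum (hmeas ε)),
    lintegral_finsetSum _ fun ε _ => Measurable.tsum (hmeas ε)]
  refine congrArg _ (Finset.sum_congr rfl fun ε _ => ?_)
  rw [lintegral_tsum fun k => (hmeas ε k).aemeasurable, gridSum]
  refine tsum_congr fun k => ?_
  rw [lintegral_indicator (measurableSet_gridCell ε k x), setLIntegral_const]

lemma Cube.vol_rpow (hn : 0 < n) (Q : Cube n) : Q.vol ^ (α / n - 1) = Q.side ^ (-(n - α)) := by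
  have hn' : (n : ℝ) ≠ 0 := by exact_mod_cast hn.ne'
  rw [Cube.vol, ← Real.rpow_natCast, ← Real.rpow_mul Q.side_pos.le]
  congr 1
  field_simp
  ring

lemma fracMax_le_sum (hn : 0 < n) (hαn : α < n) (f : Rn n → ℝ≥0∞) (x : Rn n) :
    fracMax α f x ≤ ENNReal.ofReal (6 ^ (n - α)) *
      ∑ ε, gridMax ε (n - α) (volume.withDensity f) x := by
  refine iSup₂_le fun Q hx => ?_
  obtain ⟨ε, k, hk, hle⟩ := exists_gridIdx_eq_of_sub_le (a := Q.corner)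
    (b := fun d => Q.corner d + Q.side) (fun d => by linarith [Q.side_pos]) Q.side_pos
    (fun d => by linarith) (sub_nonneg.2 hαn.le)
  rw [Q.vol_rpow hn, ← withDensity_apply']
  have hsub : Q.set ⊆ gridCell ε k x := fun y hy =>
    (hk y fun d => ⟨(hy d).1, (hy d).2.le⟩).trans (hk x fun d => ⟨(hx d).1, (hx d).2.le⟩).symm
  calc _ ≤ ENNReal.ofReal (6 ^ (n - α)) * 2 ^ (-((n - α) * k)) *
        volume.withDensity f (gridCell ε k x) := mul_le_mul' hle (measure_mono hsub)
    _ = ENNReal.ofReal (6 ^ (n - α)) *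
        (2 ^ (-((n - α) * k)) * volume.withDensity f (gridCell ε k x)) := mul_assoc _ _ _
    _ ≤ ENNReal.ofReal (6 ^ (n - α)) * gridMax ε (n - α) (volume.withDensity f) x := by
        gcongr
        exact le_iSup (fun k : ℤ => (2 : ℝ≥0∞) ^ (-((n - α) * k)) *
          volume.withDensity f (gridCell ε k x)) k
    _ ≤ _ := by
        gcongr
        exact Finset.single_le_sum (f := fun ε => gridMax ε (n - α) (volume.withDensity f) x)
          (fun _ _ => zero_le) (Finset.mem_univ ε)

lemma gridMax_le_fracMax (hn : 0 < n) (ε : Fin n → Bool) (f : Rn n → ℝ≥0∞) (x : Rn n) :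
    gridMax ε (n - α) (volume.withDensity f) x ≤ fracMax α f x := by
  refine iSup_le fun k => ?_
  have hx : x ∈ (gridCube ε k x).set := by
    rw [gridCube_set]
    rfl
  refine le_trans (le_of_eq ?_) (le_iSup₂ (gridCube ε k x) hx)
  rw [Cube.vol_rpow hn, ← withDensity_apply', gridCube_set]
  change _ = ENNReal.ofReal (((2 : ℝ) ^ k) ^ (-(n - α))) * _
  rw [ofReal_two_zpow_rpow, neg_mul]

/-- The measure with density `w` with respect to Lebesgue measure. -/
def weightMeasure (w : Rn n → ℝ) : Measure (Rn n) :=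
  volume.withDensity fun x => ENNReal.ofReal (w x)

instance (w : Rn n → ℝ) : SigmaFinite (weightMeasure w) := SigmaFinite.withDensity_ofReal _

lemma nullSingletonClass_weightMeasure (hn : 0 < n) (w : Rn n → ℝ) :
    NullSingletonClass (weightMeasure w) := by
  have : Nonempty (Fin n) := ⟨⟨0, hn⟩⟩
  exact nullSingletonClass_withDensity _

lemma lintegral_weightMeasure {w : Rn n → ℝ} (hw : Measurable w) (f : Rn n → ℝ≥0∞) :
    ∫⁻ x, f x ∂weightMeasure w = ∫⁻ x, f x * ENNReal.ofReal (w x) := by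
  rw [weightMeasure, lintegral_withDensity_eq_lintegral_mul_non_measurable _ hw.ennreal_ofReal
    (Filter.Eventually.of_forall fun x => ENNReal.ofReal_lt_top)]
  simp only [Pi.mul_apply, mul_comm]

lemma weightMeasure_apply (w : Rn n → ℝ) (s : Set (Rn n)) :
    weightMeasure w s = ∫⁻ x in s, ENNReal.ofReal (w x) := withDensity_apply' _ _

lemma weightMeasure_cube_ne_top {w : Rn n → ℝ} (hw : IsWeight w) (Q : Cube n) :
    weightMeasure w Q.set ≠ ∞ := by
  have hsub : Q.set ⊆ Icc Q.corner fun d => Q.corner d + Q.side := fun x hx =>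
    ⟨fun d => (hx d).1, fun d => (hx d).2.le⟩
  have hint := hw.2.2.integrableOn_isCompact (isCompact_Icc (a := Q.corner)
    (b := fun d => Q.corner d + Q.side))
  refine ne_of_lt (lt_of_le_of_lt (measure_mono hsub) ?_)
  rw [weightMeasure_apply]
  exact lt_of_le_of_lt (lintegral_mono fun x => Real.ofReal_le_enorm _) hint.2

lemma withDensity_mulW {w : Rn n → ℝ} (hw : Measurable w) {g : Rn n → ℝ≥0∞} (hg : Measurable g) :
    volume.withDensity (mulW g w) = (weightMeasure w).withDensity g := by
  rw [weightMeasure, ← withDensity_mul _ hw.ennreal_ofReal hg]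
  refine congrArg _ (funext fun x => ?_)
  simp [mulW, mul_comm]

lemma riesz_mulW {w : Rn n → ℝ} (hw : Measurable w) (f : Rn n → ℝ≥0∞) (x : Rn n) :
    riesz α (mulW f w) x = ∫⁻ y, f y * rieszKer α x y ∂weightMeasure w := by
  rw [lintegral_weightMeasure hw]
  refine lintegral_congr fun y => ?_
  simp only [mulW, rieszKer]
  ring

lemma LpW_eq {w : Rn n → ℝ} (hw : Measurable w) (f : Rn n → ℝ≥0∞) (p : ℝ) :
    LpW f p w = (∫⁻ x, f x ^ p ∂weightMeasure w) ^ (1 / p) := by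
  rw [LpW, lintegral_weightMeasure hw]

end Comparison

section Duality

variable {X : Type*} [MeasurableSpace X]

lemma ENNReal.le_add_tsum_ite (t b : ℝ≥0∞) (ht0 : t ≠ 0) (ht : t ≠ ∞) :
    b ≤ t + ∑' k : ℕ, if 2 ^ k * t < b then 2 ^ k * t else 0 := by
  have key : ∀ k : ℕ, min b (2 ^ k * t) ≤
      t + ∑ j ∈ Finset.range k, if 2 ^ j * t < b then 2 ^ j * t else 0 := fun k => by
    induction k with
    | zero => simp
    | succ k ih =>
      rw [Finset.sum_range_succ, ← add_assoc]
      by_cases hk : 2 ^ k * t < b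
      · rw [min_eq_right hk.le] at ih
        rw [if_pos hk]
        refine (min_le_right _ _).trans ?_
        rw [pow_succ, mul_two, add_mul]
        gcongr
      · rw [if_neg hk, add_zero]
        refine le_trans ?_ ih
        rw [min_eq_left (not_lt.1 hk)]
        exact min_le_left _ _
  refine le_of_forall_lt fun c hc => ?_
  obtain ⟨c', hcc', hc'⟩ := exists_between hc
  obtain ⟨k, hk⟩ := ENNReal.exists_nat_gt (ENNReal.div_ne_top hc'.ne_top ht0)
  have h2 : c' ≤ 2 ^ k * t := by
    rw [← ENNReal.div_le_iff ht0 ht]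
    refine hk.le.trans ?_
    exact_mod_cast Nat.lt_two_pow_self.le
  refine hcc'.trans_le (((le_min hc'.le h2).trans (key k)).trans ?_)
  gcongr
  exact ENNReal.sum_le_tsum _

/-- Kolmogorov's inequality before optimising in the threshold `t`. -/
lemma lintegral_le_of_weak_threshold {m : Measure X} {F : X → ℝ≥0∞} (hF : Measurable F) {q : ℝ}
    (hq : 1 < q) {W : ℝ≥0∞}
    (hW : ∀ t : ℝ≥0∞, t ≠ 0 → t ≠ ∞ → t * m {x | t < F x} ^ (1 / q) ≤ W)
    {t : ℝ≥0∞} (ht0 : t ≠ 0) (ht : t ≠ ∞) :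
    ∫⁻ x, F x ∂m ≤ t * m univ + geomConst (q - 1) * (W ^ q * t ^ (1 - q)) := by
  have hq0 : 0 < q := by linarith
  have hmeas : ∀ k : ℕ, MeasurableSet {x | 2 ^ k * t < F x} := fun k =>
    measurableSet_lt measurable_const hF
  calc ∫⁻ x, F x ∂m
      ≤ ∫⁻ x, (t + ∑' k : ℕ, if 2 ^ k * t < F x then 2 ^ k * t else 0) ∂m :=
        lintegral_mono fun x => ENNReal.le_add_tsum_ite t (F x) ht0 ht
    _ = t * m univ + ∑' k : ℕ, 2 ^ k * t * m {x | 2 ^ k * t < F x} := by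
        rw [lintegral_add_left measurable_const, lintegral_const, lintegral_tsum fun k =>
          (Measurable.ite (hmeas k) measurable_const measurable_const).aemeasurable]
        refine congrArg _ (tsum_congr fun k => ?_)
        rw [← lintegral_indicator_const (hmeas k)]
        exact lintegral_congr fun x => by simp [indicator]
    _ ≤ t * m univ + ∑' k : ℕ, W ^ q * t ^ (1 - q) * ((2 : ℝ≥0∞) ^ (-(q - 1))) ^ k := by
        refine add_le_add le_rfl (ENNReal.tsum_le_tsum fun k => ?_)
        have hk0 : 2 ^ k * t ≠ 0 := mul_ne_zero (by simp) ht0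
        have hk : 2 ^ k * t ≠ ∞ := ENNReal.mul_ne_top (by simp) ht
        have h1 := ENNReal.rpow_le_rpow (hW _ hk0 hk) hq0.le
        rw [ENNReal.mul_rpow_of_nonneg _ _ hq0.le, ← ENNReal.rpow_mul,
          one_div_mul_cancel hq0.ne', ENNReal.rpow_one] at h1
        calc 2 ^ k * t * m {x | 2 ^ k * t < F x}
            = (2 ^ k * t) ^ (1 - q) * ((2 ^ k * t) ^ q * m {x | 2 ^ k * t < F x}) := by
              rw [← mul_assoc, ← ENNReal.rpow_add _ _ hk0 hk, sub_add_cancel, ENNReal.rpow_one]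
          _ ≤ (2 ^ k * t) ^ (1 - q) * W ^ q := by gcongr
          _ = _ := by
              have h2 : ((2 : ℝ≥0∞) ^ k) ^ (1 - q) = ((2 : ℝ≥0∞) ^ (-(q - 1))) ^ k := by
                rw [← two_rpow_neg_mul_natCast, ← ENNReal.rpow_natCast, ← ENNReal.rpow_mul]
                congr 1
                ring
              rw [ENNReal.mul_rpow_of_ne_top (by simp) ht, h2]
              ring
    _ = _ := by
        rw [ENNReal.tsum_mul_left, tsum_two_rpow_neg_pow, mul_comm (geomConst _)]

/-- Kolmogorov's inequality. -/
lemma lintegral_le_of_weak {m : Measure X} [IsFiniteMeasure m] {F : X → ℝ≥0∞} (hF : Measurable F)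
    {q s : ℝ} (hqs : q.HolderConjugate s) {W : ℝ≥0∞}
    (hW : ∀ t : ℝ≥0∞, t ≠ 0 → t ≠ ∞ → t * m {x | t < F x} ^ (1 / q) ≤ W) :
    ∫⁻ x, F x ∂m ≤ (1 + geomConst (q - 1)) * W * m univ ^ (1 / s) := by
  have hq := hqs.lt
  have hq0 := hqs.pos
  have hss : 1 / s = 1 - 1 / q := by
    have := hqs.inv_add_inv_eq_one
    rw [one_div, one_div]
    linarith
  have main : ∀ {t : ℝ≥0∞}, t ≠ 0 → t ≠ ∞ → _ :=
    fun {t} h0 h1 => lintegral_le_of_weak_threshold hF hq hW (t := t) h0 h1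
  set M := m univ with hM
  have hMt : M ≠ ∞ := measure_ne_top m univ
  rcases eq_or_ne M 0 with hM0 | hM0
  · rw [Measure.measure_univ_eq_zero.1 hM0]
    simp
  rcases eq_or_ne W ∞ with rfl | hWt
  · rw [ENNReal.mul_top (by simp), ENNReal.top_mul]
    · exact le_top
    · exact (ENNReal.rpow_pos (pos_iff_ne_zero.2 hM0) hMt).ne'
  rcases eq_or_ne W 0 with rfl | hW0
  · have h1 : ∀ t : ℝ≥0∞, t ≠ 0 → t ≠ ∞ → ∫⁻ x, F x ∂m ≤ t * M := fun t h0 ht => by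
      simpa [ENNReal.zero_rpow_of_pos hq0] using main h0 ht
    by_contra! hc
    set c := ∫⁻ x, F x ∂m
    have hc0 : c ≠ 0 := (lt_of_le_of_lt zero_le hc).ne'
    have hct : c ≠ ∞ := ne_top_of_le_ne_top (by simpa using hMt) (h1 1 one_ne_zero one_ne_top)
    have h2 := h1 (c / 2 / M) (by simp [hc0, hMt])
      (ENNReal.div_ne_top (ENNReal.div_ne_top hct two_ne_zero) hM0)
    rw [ENNReal.div_mul_cancel hM0 hMt] at h2
    exact absurd (ENNReal.half_lt_self hc0 hct) (not_lt.2 h2)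
  have hMr0 : M ^ (-(1 / q)) ≠ 0 := (ENNReal.rpow_pos (pos_iff_ne_zero.2 hM0) hMt).ne'
  have hMrt : M ^ (-(1 / q)) ≠ ∞ := ENNReal.rpow_ne_top_of_ne_zero hM0 hMt
  refine (main (t := W * M ^ (-(1 / q))) (mul_ne_zero hW0 hMr0)
    (ENNReal.mul_ne_top hWt hMrt)).trans (le_of_eq ?_)
  have e1 : W * M ^ (-(1 / q)) * M = W * M ^ (1 / s) := by
    conv_lhs => rw [mul_assoc, ← ENNReal.rpow_one M, ← ENNReal.rpow_mul,
      ← ENNReal.rpow_add _ _ hM0 hMt]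
    rw [hss, one_mul, neg_add_eq_sub]
  have e2 : W ^ q * (W * M ^ (-(1 / q))) ^ (1 - q) = W * M ^ (1 / s) := by
    rw [ENNReal.mul_rpow_of_ne_top hWt hMrt, ← mul_assoc, ← ENNReal.rpow_add _ _ hW0 hWt,
      ← ENNReal.rpow_mul, add_sub_cancel, ENNReal.rpow_one, hss]
    congr 2
    field_simp
    ring
  rw [e1, e2]
  ring

variable {μ ν : Measure X} {K : X → X → ℝ≥0∞}

lemma setLIntegral_lintegral_kernel [SFinite μ] [SFinite ν] (hK : Measurable (Function.uncurry K))
    {f : X → ℝ≥0∞} (hf : Measurable f) (E : Set X) :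
    ∫⁻ x in E, ∫⁻ y, f y * K x y ∂ν ∂μ = ∫⁻ y, f y * ∫⁻ x in E, K x y ∂μ ∂ν := by
  rw [lintegral_lintegral_swap ((hf.comp measurable_snd).mul hK).aemeasurable]
  exact lintegral_congr fun y => lintegral_const_mul _ hK.of_uncurry_right

lemma measurable_setLIntegral_kernel [SFinite μ] (hK : Measurable (Function.uncurry K))
    (E : Set X) : Measurable fun y => ∫⁻ x in E, K x y ∂μ :=
  Measurable.lintegral_prod_left' (f := Function.uncurry K) hK

lemma measurable_lintegral_mul_kernel [SFinite ν] (hK : Measurable (Function.uncurry K))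
    {f : X → ℝ≥0∞} (hf : Measurable f) : Measurable fun x => ∫⁻ y, f y * K x y ∂ν :=
  Measurable.lintegral_prod_right' (f := fun z : X × X => f z.2 * K z.1 z.2)
    ((hf.comp measurable_snd).mul hK)

/-- A weak type bound for an integral operator gives a restricted strong type bound for its
adjoint. -/
lemma lintegral_kernel_rpow_le_of_weak [SFinite μ] [SigmaFinite ν]
    (hK : Measurable (Function.uncurry K)) {p q r s : ℝ} (hpr : p.HolderConjugate r)
    (hqs : q.HolderConjugate s) {N : ℝ≥0∞}
    (hN : ∀ f : X → ℝ≥0∞, Measurable f → ∫⁻ y, f y ^ p ∂ν ≠ ∞ → ∀ t : ℝ≥0∞, t ≠ 0 → t ≠ ∞ →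
      t * μ {x | t < ∫⁻ y, f y * K x y ∂ν} ^ (1 / q) ≤ N * (∫⁻ y, f y ^ p ∂ν) ^ (1 / p))
    {E : Set X} (hE' : μ E ≠ ∞) :
    ∫⁻ y, (∫⁻ x in E, K x y ∂μ) ^ r ∂ν ≤ ((1 + geomConst (q - 1)) * N * μ E ^ (1 / s)) ^ r := by
  have hp0 := hpr.pos
  have hr0 := hpr.symm.pos
  have hr1 := hpr.symm.lt
  set h : X → ℝ≥0∞ := fun y => ∫⁻ x in E, K x y ∂μ
  have hmeas : Measurable h := measurable_setLIntegral_kernel hK E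
  set D : ℝ≥0∞ := (1 + geomConst (q - 1)) * N * μ E ^ (1 / s) with hD
  set φ : ℕ → X → ℝ≥0∞ := fun j => (spanningSets ν j).indicator fun y => min (h y) j with hφ
  have hφm : ∀ j, Measurable (φ j) := fun j =>
    (hmeas.min measurable_const).indicator (measurableSet_spanningSets ν j)
  have hφle : ∀ j y, φ j y ≤ h y := fun j y =>
    (indicator_le_self' (fun _ _ => zero_le) y).trans (min_le_left _ _)
  have hmono : Monotone φ := fun i j hij y => by
    refine (indicator_le_indicator_of_subset (monotone_spanningSets ν hij)
      (fun _ => zero_le) y).trans (indicator_le_indicator ?_)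
    gcongr
  have hsup : ∀ y, h y ^ r ≤ ⨆ j, φ j y ^ r := fun y => by
    rw [← ENNReal.le_rpow_inv_iff hr0]
    refine le_of_forall_lt_imp_le_of_dense fun c hc => ?_
    obtain ⟨i, hi⟩ := ENNReal.exists_nat_gt hc.ne_top
    rw [ENNReal.le_rpow_inv_iff hr0]
    refine le_trans ?_ (le_iSup _ (max i (spanningSetsIndex ν y)))
    gcongr
    simp only [hφ]
    rw [indicator_of_mem (mem_spanningSets_of_index_le ν y (le_max_right _ _))]
    refine le_min hc.le (hi.le.trans ?_)
    exact_mod_cast le_max_left _ _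
  have hbound : ∀ j, ∫⁻ y, φ j y ^ r ∂ν ≤ D ^ r := fun j => by
    set A := ∫⁻ y, φ j y ^ r ∂ν with hA
    have hfin : A ≠ ∞ := by
      refine ne_top_of_le_ne_top (b := (j : ℝ≥0∞) ^ r * ν (spanningSets ν j))
        (ENNReal.mul_ne_top (by simp [hr0.le]) (measure_spanningSets_lt_top ν j).ne) ?_
      rw [← lintegral_indicator_const (measurableSet_spanningSets ν j)]
      refine lintegral_mono fun y => ?_
      by_cases hy : y ∈ spanningSets ν j
      · simp only [hφ, indicator_of_mem hy]
        gcongr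
        exact min_le_right _ _
      · simp [hφ, indicator_of_notMem hy, ENNReal.zero_rpow_of_pos hr0]
    rcases eq_or_ne A 0 with hA0 | hA0
    · rw [hA0]
      exact zero_le
    have hfp : ∀ y, (φ j y ^ (r - 1)) ^ p = φ j y ^ r := fun y => by
      rw [← ENNReal.rpow_mul, hpr.symm.sub_one_mul_conj]
    have hfm : Measurable fun y => φ j y ^ (r - 1) := (hφm j).pow_const _
    have h1 : A ≤ D * A ^ (1 / p) := by
      calc A ≤ ∫⁻ y, φ j y ^ (r - 1) * h y ∂ν := by
            refine lintegral_mono fun y => ?_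
            have := ENNReal.rpow_add_of_nonneg (x := φ j y) (r - 1) 1 (by linarith) (by norm_num)
            rw [sub_add_cancel, ENNReal.rpow_one] at this
            rw [this]
            gcongr
            exact hφle j y
        _ = ∫⁻ x in E, ∫⁻ y, φ j y ^ (r - 1) * K x y ∂ν ∂μ :=
            (setLIntegral_lintegral_kernel hK hfm E).symm
        _ ≤ (1 + geomConst (q - 1)) * (N * A ^ (1 / p)) * μ.restrict E univ ^ (1 / s) := by
            have : IsFiniteMeasure (μ.restrict E) := ⟨by simpa using hE'.lt_top⟩
            refine lintegral_le_of_weak (measurable_lintegral_mul_kernel hK hfm) hqs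
              fun t h0 ht => ?_
            have h2 := hN _ hfm (by simpa only [hfp] using hfin) t h0 ht
            simp only [hfp] at h2
            refine le_trans ?_ h2
            gcongr
            · exact hqs.one_div_nonneg
            · exact Measure.restrict_le_self
        _ = D * A ^ (1 / p) := by
            rw [Measure.restrict_apply_univ, hD]
            ring
    have hAp0 : A ^ (1 / p) ≠ 0 := (ENNReal.rpow_pos (pos_iff_ne_zero.2 hA0) hfin).ne'
    have hApt : A ^ (1 / p) ≠ ∞ := ENNReal.rpow_ne_top_of_nonneg (by positivity) hfin
    have h3 : A ^ (1 / r) ≤ D := by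
      rw [← ENNReal.mul_le_mul_iff_left hAp0 hApt, ← ENNReal.rpow_add _ _ hA0 hfin]
      rwa [one_div, one_div, hpr.symm.inv_add_inv_eq_one, ENNReal.rpow_one, ← one_div]
    calc A = (A ^ (1 / r)) ^ r := by
          rw [← ENNReal.rpow_mul, one_div_mul_cancel hr0.ne', ENNReal.rpow_one]
      _ ≤ D ^ r := by gcongr
  calc ∫⁻ y, h y ^ r ∂ν ≤ ∫⁻ y, ⨆ j, φ j y ^ r ∂ν := lintegral_mono hsup
    _ = ⨆ j, ∫⁻ y, φ j y ^ r ∂ν := lintegral_iSup (fun j => (hφm j).pow_const _)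
        fun i j hij y => ENNReal.rpow_le_rpow (hmono hij y) hr0.le
    _ ≤ D ^ r := iSup_le hbound

/-- A restricted strong type bound for the adjoint of an integral operator gives a weak type bound
for the operator. -/
lemma weak_le_of_lintegral_kernel_rpow_le [SigmaFinite μ] [SFinite ν]
    (hK : Measurable (Function.uncurry K)) {p q r s : ℝ} (hpr : p.HolderConjugate r)
    (hqs : q.HolderConjugate s) {B : ℝ≥0∞}
    (hB : ∀ E, MeasurableSet E → μ E ≠ ∞ →
      (∫⁻ y, (∫⁻ x in E, K x y ∂μ) ^ r ∂ν) ^ (1 / r) ≤ B * μ E ^ (1 / s))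
    {f : X → ℝ≥0∞} (hf : Measurable f) {t : ℝ≥0∞} (ht0 : t ≠ 0) (ht : t ≠ ∞) :
    t * μ {x | t < ∫⁻ y, f y * K x y ∂ν} ^ (1 / q) ≤ B * (∫⁻ y, f y ^ p ∂ν) ^ (1 / p) := by
  have hq0 := hqs.pos
  set S := {x | t < ∫⁻ y, f y * K x y ∂ν} with hS
  have hSm : MeasurableSet S :=
    measurableSet_lt measurable_const (measurable_lintegral_mul_kernel hK hf)
  set R := B * (∫⁻ y, f y ^ p ∂ν) ^ (1 / p) with hR
  have key : ∀ E ⊆ S, MeasurableSet E → μ E ≠ ∞ → t * μ E ^ (1 / q) ≤ R := fun E hES hE hE' => by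
    rcases eq_or_ne (μ E) 0 with h0 | h0
    · simp [h0, hq0]
    have h1 : t * μ E ≤ R * μ E ^ (1 / s) := by
      calc t * μ E = ∫⁻ _ in E, t ∂μ := (setLIntegral_const _ _).symm
        _ ≤ ∫⁻ x in E, ∫⁻ y, f y * K x y ∂ν ∂μ :=
            setLIntegral_mono' hE fun x hx => (hES hx).le
        _ = ∫⁻ y, f y * ∫⁻ x in E, K x y ∂μ ∂ν := setLIntegral_lintegral_kernel hK hf E
        _ ≤ (∫⁻ y, f y ^ p ∂ν) ^ (1 / p) * (∫⁻ y, (∫⁻ x in E, K x y ∂μ) ^ r ∂ν) ^ (1 / r) :=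
            ENNReal.lintegral_mul_le_Lp_mul_Lq ν hpr hf.aemeasurable
              (measurable_setLIntegral_kernel hK E).aemeasurable
        _ ≤ (∫⁻ y, f y ^ p ∂ν) ^ (1 / p) * (B * μ E ^ (1 / s)) := by
            gcongr
            exact hB E hE hE'
        _ = R * μ E ^ (1 / s) := by
            rw [hR]
            ring
    have hs0 : μ E ^ (1 / s) ≠ 0 := (ENNReal.rpow_pos (pos_iff_ne_zero.2 h0) hE').ne'
    have hst : μ E ^ (1 / s) ≠ ∞ := ENNReal.rpow_ne_top_of_ne_zero h0 hE'
    rw [← ENNReal.mul_le_mul_iff_left hs0 hst, mul_assoc, ← ENNReal.rpow_add _ _ h0 hE']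
    rwa [one_div, one_div, hqs.inv_add_inv_eq_one, ENNReal.rpow_one, ← one_div]
  have hiff : ∀ M : ℝ≥0∞, t * M ^ (1 / q) ≤ R ↔ M ≤ (R / t) ^ q := fun M => by
    rw [mul_comm, ← ENNReal.le_div_iff_mul_le (Or.inl ht0) (Or.inl ht), one_div,
      ENNReal.rpow_inv_le_iff hq0]
  rw [hiff, ← Measure.iSup_restrict_spanningSets (μ := μ) S]
  refine iSup_le fun j => ?_
  rw [Measure.restrict_apply hSm, ← hiff]
  exact key _ inter_subset_left (hSm.inter (measurableSet_spanningSets μ j))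
    (measure_inter_lt_top_of_right_ne_top (measure_spanningSets_lt_top μ j).ne).ne

end Duality

section Comparability

lemma lintegral_rpow_le_of_le_mul_sum {X ι : Type*} [MeasurableSpace X] [Fintype ι]
    {ν : Measure X} {F : X → ℝ≥0∞} {G : ι → X → ℝ≥0∞} (hG : ∀ i, Measurable (G i)) {r : ℝ}
    (hr : 0 < r) {C D : ℝ≥0∞} (hF : ∀ x, F x ≤ C * ∑ i, G i x)
    (hD : ∀ i, ∫⁻ x, G i x ^ r ∂ν ≤ D ^ r) :
    ∫⁻ x, F x ^ r ∂ν ≤ (C * Fintype.card ι * (Fintype.card ι : ℝ≥0∞) ^ (1 / r) * D) ^ r := by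
  have hsum : ∀ x, F x ^ r ≤ (C * Fintype.card ι) ^ r * ∑ i, G i x ^ r := fun x => by
    have h1 := ENNReal.rpow_tsum_le (b := fun i => G i x) (w := fun _ => 1) (c := fun i => G i x)
      (fun i => (one_mul _).ge) hr
    simp only [tsum_fintype, Finset.sum_const, Finset.card_univ, nsmul_eq_mul, mul_one] at h1
    calc F x ^ r ≤ (C * ∑ i, G i x) ^ r := ENNReal.rpow_le_rpow (hF x) hr.le
      _ ≤ C ^ r * ((Fintype.card ι : ℝ≥0∞) ^ r * ∑ i, G i x ^ r) := by
          rw [ENNReal.mul_rpow_of_nonneg _ _ hr.le]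
          gcongr
      _ = _ := by rw [ENNReal.mul_rpow_of_nonneg _ _ hr.le, mul_assoc]
  calc ∫⁻ x, F x ^ r ∂ν ≤ (C * Fintype.card ι) ^ r * ∑ i, ∫⁻ x, G i x ^ r ∂ν := by
        refine (lintegral_mono hsum).trans (le_of_eq ?_)
        rw [lintegral_const_mul _ (Finset.measurable_sum _ fun i _ => (hG i).pow_const r),
          lintegral_finsetSum _ fun i _ => (hG i).pow_const r]
    _ ≤ (C * Fintype.card ι) ^ r * ∑ _i : ι, D ^ r := by
        gcongr with i
        exact hD i
    _ = _ := by
        rw [Finset.sum_const, Finset.card_univ, nsmul_eq_mul, ENNReal.mul_rpow_of_nonneg _ D hr.le,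
          ENNReal.mul_rpow_of_nonneg _ (_ ^ (1 / r)) hr.le, ← ENNReal.rpow_mul,
          one_div_mul_cancel hr.ne', ENNReal.rpow_one, mul_assoc]

variable {n : ℕ} {α : ℝ}

lemma measurable_measure_gridCell (ε : Fin n → Bool) (m : Measure (Rn n)) (k : ℤ) :
    Measurable fun x => m (gridCell ε k x) :=
  (measurable_of_countable fun v : Fin n → ℤ => m {y | gridIdx ε k y = v}).comp
    (measurable_gridIdx ε k)

lemma measurable_gridMax (ε : Fin n → Bool) (β : ℝ) (m : Measure (Rn n)) :
    Measurable (gridMax ε β m) :=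
  Measurable.iSup fun k => (measurable_measure_gridCell ε m k).const_mul _

lemma measurable_gridSum (ε : Fin n → Bool) (β : ℝ) (m : Measure (Rn n)) :
    Measurable (gridSum ε β m) :=
  Measurable.tsum fun k => (measurable_measure_gridCell ε m k).const_mul _

lemma mul_measure_rpow_le_opNormWeak {p q : ℝ} (hp : 0 < p) (hq : 0 < q) {u σ : Rn n → ℝ}
    (hσ : Measurable σ) {f : Rn n → ℝ≥0∞} (hf : Measurable f)
    (hfp : ∫⁻ y, f y ^ p ∂weightMeasure σ ≠ ∞) {t : ℝ≥0∞} (ht0 : t ≠ 0) (ht : t ≠ ∞) :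
    t * weightMeasure u {x | t < ∫⁻ y, f y * rieszKer α x y ∂weightMeasure σ} ^ (1 / q) ≤
      opNormWeak (riesz α) p q σ u * (∫⁻ y, f y ^ p ∂weightMeasure σ) ^ (1 / p) := by
  rcases eq_or_ne (∫⁻ y, f y ^ p ∂weightMeasure σ) 0 with h0 | h0
  · have hz : ∀ x, ∫⁻ y, f y * rieszKer α x y ∂weightMeasure σ = 0 := fun x => by
      rw [lintegral_eq_zero_iff (hf.pow_const p)] at h0
      refine (lintegral_congr_ae ?_).trans lintegral_zero
      filter_upwards [h0] with y hy
      have hy' : f y = 0 := by simpa [hp, hp.le, hp.not_gt] using hy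
      simp [hy']
    simp [hz, hq]
  have hL0 : LpW f p σ ≠ 0 := by
    rw [LpW_eq hσ]
    exact (ENNReal.rpow_pos (pos_iff_ne_zero.2 h0) hfp).ne'
  have hLt : LpW f p σ ≠ ∞ := by
    rw [LpW_eq hσ]
    exact ENNReal.rpow_ne_top_of_ne_zero h0 hfp
  have h1 : WeakLpW (riesz α (mulW f σ)) q u / LpW f p σ ≤ opNormWeak (riesz α) p q σ u :=
    le_iSup₂ (f := fun (f : Rn n → ℝ≥0∞) (_ : Measurable f) =>
      WeakLpW (riesz α (mulW f σ)) q u / LpW f p σ) f hf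
  rw [ENNReal.div_le_iff hL0 hLt, LpW_eq hσ] at h1
  refine le_trans ?_ h1
  have h2 := le_iSup₂ (f := fun (t : ℝ) (_ : 0 < t) => ENNReal.ofReal t *
    (∫⁻ x in {x | ENNReal.ofReal t < riesz α (mulW f σ) x}, ENNReal.ofReal (u x)) ^ (1 / q))
    t.toReal (ENNReal.toReal_pos ht0 ht)
  rw [ENNReal.ofReal_toReal ht] at h2
  simp only [riesz_mulW hσ, ← weightMeasure_apply] at h2
  simpa only [WeakLpW, riesz_mulW hσ, ← weightMeasure_apply] using h2

/-- The strong type norm of the fractional maximal operator is controlled by the weak type norm of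
the Riesz potential. -/
lemma exists_opNormStrong_fracMax_le (hn : 0 < n) (hαn : α < n) {p q r s : ℝ}
    (hpr : p.HolderConjugate r) (hqs : q.HolderConjugate s) (hsr : s ≤ r) :
    ∃ C : ℝ≥0∞, C ≠ ∞ ∧ ∀ u σ : Rn n → ℝ, IsWeight u → IsWeight σ →
      opNormStrong (fracMax α) s r u σ ≤ C * opNormWeak (riesz α) p q σ u := by
  have hr0 := hpr.symm.pos
  have hs0 := hqs.symm.pos
  set k : ℝ≥0∞ := (Fintype.card (Fin n → Bool) : ℝ≥0∞) with hk
  refine ⟨ENNReal.ofReal (6 ^ (n - α)) * k * k ^ (1 / r) * (4 * geomConst (s - 1) ^ (1 / s) *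
    (ENNReal.ofReal (n ^ (n - α)) * (1 + geomConst (q - 1)))), ?_, fun u σ hu hσ => ?_⟩
  · have h1 : geomConst (s - 1) ^ (1 / s) ≠ ∞ := ENNReal.rpow_ne_top_of_nonneg
      hqs.symm.one_div_nonneg (geomConst_ne_top (sub_pos.2 hqs.symm.lt))
    have h2 : geomConst (q - 1) ≠ ∞ := geomConst_ne_top (sub_pos.2 hqs.lt)
    have h3 : k ≠ ∞ := ENNReal.natCast_ne_top _
    have h4 : k ^ (1 / r) ≠ ∞ := ENNReal.rpow_ne_top_of_nonneg hpr.symm.one_div_nonneg h3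
    finiteness
  set N := opNormWeak (riesz α) p q σ u
  set μ := weightMeasure u with hμ
  set ν := weightMeasure σ with hν
  have : NullSingletonClass μ := nullSingletonClass_weightMeasure hn u
  refine iSup₂_le fun g hg => ?_
  rw [LpW_eq hu.1, LpW_eq hσ.1, ← hμ, ← hν]
  rcases eq_or_ne (∫⁻ x, g x ^ s ∂μ) ∞ with hgt | hgt
  · rw [hgt, ENNReal.top_rpow_of_pos (one_div_pos.2 hs0), ENNReal.div_top]
    exact zero_le
  refine ENNReal.div_le_of_le_mul ?_
  set c := ENNReal.ofReal (n ^ (n - α)) * (1 + geomConst (q - 1)) with hc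
  have hrestr : ∀ (ε : Fin n → Bool) (E : Set (Rn n)), MeasurableSet E → μ E ≠ ∞ →
      ∫⁻ x, gridMax ε (n - α) (μ.restrict E) x ^ r ∂ν ≤ (c * N) ^ r * μ E ^ (r / s) :=
    fun ε E _ hE => by
    have h1 := lintegral_kernel_rpow_le_of_weak (μ := μ) (ν := ν) (K := rieszKer α) (N := N)
      measurable_rieszKer hpr hqs
      (fun f hf hfp t ht0 ht => mul_measure_rpow_le_opNormWeak hpr.pos hqs.pos hσ.1 hf hfp ht0 ht)
      hE
    calc ∫⁻ x, gridMax ε (n - α) (μ.restrict E) x ^ r ∂ν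
        ≤ ∫⁻ y, (ENNReal.ofReal (n ^ (n - α)) * ∫⁻ x in E, rieszKer α x y ∂μ) ^ r ∂ν := by
          refine lintegral_mono fun y => ENNReal.rpow_le_rpow ?_ hr0.le
          simp only [rieszKer_comm _ y]
          exact gridMax_le_lintegral_rieszKer hn hαn ε _ y
      _ = ENNReal.ofReal (n ^ (n - α)) ^ r * ∫⁻ y, (∫⁻ x in E, rieszKer α x y ∂μ) ^ r ∂ν := by
          simp only [ENNReal.mul_rpow_of_nonneg _ _ hr0.le]
          exact lintegral_const_mul _
            ((measurable_setLIntegral_kernel measurable_rieszKer E).pow_const r)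
      _ ≤ ENNReal.ofReal (n ^ (n - α)) ^ r *
          ((1 + geomConst (q - 1)) * N * μ E ^ (1 / s)) ^ r := by gcongr
      _ = (c * N) ^ r * μ E ^ (r / s) := by
          rw [← ENNReal.mul_rpow_of_nonneg _ _ hr0.le, show r / s = 1 / s * r by ring,
            ENNReal.rpow_mul, ← ENNReal.mul_rpow_of_nonneg _ _ hr0.le, hc]
          ring_nf
  have hgrid : ∀ ε : Fin n → Bool, ∫⁻ x, gridMax ε (n - α) (μ.withDensity g) x ^ r ∂ν ≤
      (4 * geomConst (s - 1) ^ (1 / s) * (c * N) * (∫⁻ x, g x ^ s ∂μ) ^ (1 / s)) ^ r := fun ε => by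
    refine (lintegral_gridMax_withDensity_rpow_le hqs.symm.lt hsr
      (weightMeasure_cube_ne_top hu) (hrestr ε) hg hgt).trans (le_of_eq ?_)
    rw [show r / s = 1 / s * r by ring, ENNReal.rpow_mul, ENNReal.rpow_mul]
    simp only [ENNReal.mul_rpow_of_nonneg _ _ hr0.le, hμ]
  have hfinal := lintegral_rpow_le_of_le_mul_sum (F := fracMax α (mulW g u))
    (fun ε => measurable_gridMax ε _ _) hr0 (fun x => (fracMax_le_sum hn hαn (mulW g u) x).trans
      (le_of_eq (by rw [withDensity_mulW hu.1 hg]))) hgrid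
  rw [one_div r, ENNReal.rpow_inv_le_iff hr0]
  refine hfinal.trans (le_of_eq ?_)
  rw [← hk, one_div r]
  ring_nf

/-- The weak type norm of the Riesz potential is controlled by the strong type norm of the
fractional maximal operator. -/
lemma exists_opNormWeak_riesz_le (hn : 0 < n) (hαn : α < n) {p q r s : ℝ}
    (hpr : p.HolderConjugate r) (hqs : q.HolderConjugate s) (hsr : s < r) :
    ∃ C : ℝ≥0∞, C ≠ ∞ ∧ ∀ u σ : Rn n → ℝ, IsWeight u → IsWeight σ →
      opNormWeak (riesz α) p q σ u ≤ C * opNormStrong (fracMax α) s r u σ := by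
  have hr0 := hpr.symm.pos
  have hs0 := hqs.symm.pos
  set k : ℝ≥0∞ := (Fintype.card (Fin n → Bool) : ℝ≥0∞) with hk
  refine ⟨ENNReal.ofReal (6 ^ (n - α)) * k * k ^ (1 / r) * sumConst (n - α) r s ^ (1 / r),
    ?_, fun u σ hu hσ => ?_⟩
  · have h1 : sumConst (n - α) r s ≠ ∞ := sumConst_ne_top (sub_pos.2 hαn) hs0 hsr
    have h2 : sumConst (n - α) r s ^ (1 / r) ≠ ∞ := ENNReal.rpow_ne_top_of_nonneg
      hpr.symm.one_div_nonneg h1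
    have h3 : k ≠ ∞ := ENNReal.natCast_ne_top _
    have h4 : k ^ (1 / r) ≠ ∞ := ENNReal.rpow_ne_top_of_nonneg hpr.symm.one_div_nonneg h3
    finiteness
  set N := opNormStrong (fracMax α) s r u σ with hN
  set μ := weightMeasure u with hμ
  set ν := weightMeasure σ with hν
  have hrestr : ∀ (ε : Fin n → Bool) (E : Set (Rn n)), MeasurableSet E → μ E ≠ ∞ →
      ∫⁻ x, gridMax ε (n - α) (μ.restrict E) x ^ r ∂ν ≤ N ^ r * μ E ^ (r / s) :=
    fun ε E hE hEt => by
    rcases eq_or_ne (μ E) 0 with h0 | h0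
    · simp [Measure.restrict_eq_zero.2 h0, gridMax, hr0]
    have hind : Measurable (E.indicator (1 : Rn n → ℝ≥0∞)) := measurable_one.indicator hE
    have hL : LpW (E.indicator 1) s u = μ E ^ (1 / s) := by
      have h1 : ∀ x, E.indicator (1 : Rn n → ℝ≥0∞) x ^ s = E.indicator 1 x := fun x => by
        by_cases hx : x ∈ E <;> simp [hx, hs0]
      rw [LpW_eq hu.1]
      simp only [h1, lintegral_indicator_one hE, ← hμ]
    have h2 : LpW (fracMax α (mulW (E.indicator 1) u)) r σ / LpW (E.indicator 1) s u ≤ N :=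
      le_iSup₂ (f := fun (f : Rn n → ℝ≥0∞) (_ : Measurable f) =>
        LpW (fracMax α (mulW f u)) r σ / LpW f s u) _ hind
    rw [hL, ENNReal.div_le_iff (ENNReal.rpow_pos (pos_iff_ne_zero.2 h0) hEt).ne'
      (ENNReal.rpow_ne_top_of_ne_zero h0 hEt), LpW_eq hσ.1, one_div r,
      ENNReal.rpow_inv_le_iff hr0, ENNReal.mul_rpow_of_nonneg _ _ hr0.le, ← ENNReal.rpow_mul,
      one_div_mul_eq_div] at h2
    refine le_trans (lintegral_mono fun x => ENNReal.rpow_le_rpow ?_ hr0.le) h2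
    rw [← withDensity_indicator_one hE, ← withDensity_mulW hu.1 hind]
    exact gridMax_le_fracMax hn ε _ x
  have hgrid : ∀ E, MeasurableSet E → μ E ≠ ∞ → ∀ ε : Fin n → Bool,
      ∫⁻ x, gridSum ε (n - α) (μ.restrict E) x ^ r ∂ν ≤
        (sumConst (n - α) r s ^ (1 / r) * (N * μ E ^ (1 / s))) ^ r := fun E _ hEt ε => by
    have : IsFiniteMeasure (μ.restrict E) := ⟨by simpa using hEt.lt_top⟩
    refine (lintegral_gridSum_rpow_le (A := N ^ r) hs0 hsr fun F hF => ?_).trans (le_of_eq ?_)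
    · rw [Measure.restrict_restrict hF, Measure.restrict_apply hF]
      exact hrestr ε _ (hF.inter ‹MeasurableSet E›)
        (ne_top_of_le_ne_top hEt (measure_mono inter_subset_right))
    · rw [Measure.restrict_apply_univ, show r / s = 1 / s * r by ring, ENNReal.rpow_mul,
        ← ENNReal.mul_rpow_of_nonneg _ _ hr0.le, ENNReal.mul_rpow_of_nonneg _ (N * _) hr0.le,
        ← ENNReal.rpow_mul (sumConst _ _ _), one_div_mul_cancel hr0.ne', ENNReal.rpow_one]
  refine iSup₂_le fun f hf => ENNReal.div_le_of_le_mul (iSup₂_le fun t ht => ?_)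
  simp only [riesz_mulW hσ.1, ← weightMeasure_apply]
  rw [LpW_eq hσ.1]
  refine weak_le_of_lintegral_kernel_rpow_le (K := rieszKer α) measurable_rieszKer hpr hqs
    (fun E hE hEt => ?_) hf (by simpa using ht) ENNReal.ofReal_ne_top
  have hfinal := lintegral_rpow_le_of_le_mul_sum
    (F := fun y => ∫⁻ x in E, rieszKer α x y ∂μ) (fun ε => measurable_gridSum ε _ _) hr0
    (fun y => by
      simp only [rieszKer_comm _ y]
      exact lintegral_rieszKer_le_sum hαn (μ.restrict E) y) (hgrid E hE hEt)
  rw [one_div r, ENNReal.rpow_inv_le_iff hr0]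
  refine hfinal.trans (le_of_eq ?_)
  rw [← hk, ← hμ, one_div r]
  ring_nf

end Comparability

/-- weak-type part of the fractional Muckenhoupt–Wheeden theorem:
for `0 < α < n` and `1 < p < q < ∞`, the weak `(p,q)` operator norm of `I_α(·σ)` is
comparable to the strong `(q',p')` operator norm of `M_α(·u)`, with constants depending
only on `n, α, p, q`. -/
theorem stmt0 (n : ℕ) (hn : 0 < n) (α p q : ℝ) (hα : 0 < α) (hαn : α < n)
    (hp : 1 < p) (hpq : p < q) :
    ∃ c C : ℝ≥0∞, 0 < c ∧ C < ∞ ∧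
      ∀ u σ : Rn n → ℝ, IsWeight u → IsWeight σ →
        c * opNormStrong (fracMax α) (conjExp q) (conjExp p) u σ ≤
            opNormWeak (riesz α) p q σ u ∧
          opNormWeak (riesz α) p q σ u ≤
            C * opNormStrong (fracMax α) (conjExp q) (conjExp p) u σ := by
  have hpr : p.HolderConjugate (conjExp p) := Real.HolderConjugate.conjExponent hp
  have hqs : q.HolderConjugate (conjExp q) := Real.HolderConjugate.conjExponent (hp.trans hpq)
  have hsr : conjExp q < conjExp p := by
    rw [conjExp, conjExp, div_lt_div_iff₀ (by linarith) (by linarith)]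
    linarith
  obtain ⟨C₁, hC₁, h₁⟩ := exists_opNormStrong_fracMax_le hn hαn hpr hqs hsr.le
  obtain ⟨C₂, hC₂, h₂⟩ := exists_opNormWeak_riesz_le hn hαn hpr hqs hsr
  refine ⟨C₁⁻¹, C₂, ENNReal.inv_pos.2 hC₁, hC₂.lt_top, fun u σ hu hσ => ⟨?_, h₂ u σ hu hσ⟩⟩
  rw [mul_comm, ← div_eq_mul_inv]
  refine ENNReal.div_le_of_le_mul ?_
  rw [mul_comm]
  exact h₁ u σ hu hσ
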